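/- arXiv:1301.4456 — 3 statements merged into one kernel-verified Lean document; each statement's English description precedes it below -/
import Mathlib

section
/- Let (X,d) be a metric space with marked point p, and suppose every pretangent space Ω_{p,r̃}^X is separable and tangent. Then the following are equivalent: (i) every pretangent space Ω_{p,r̃}^X is a Ptolemaic, Busemann convex geodesic metric space (i.e., a CAT(0) space by the Foertsch–Lytchak–Schroeder characterization); (ii) X is Busemann convex at p and liminf_{w,x,y,z→p} A₃(w,x,y,z) ≥ 0. -/
open Filter Topology

universe u

section Defs

variable {X : Type u} [MetricSpace X]

/-- A normalizing sequence is a sequence of positive reals tending to zero. -/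
def IsNormalizingSeq (r : ℕ → ℝ) : Prop :=
  (∀ n, 0 < r n) ∧ Tendsto r atTop (𝓝 0)

/-- Two sequences of points of `X` are mutually stable w.r.t. `r` if
`d(x_n, y_n)/r_n` converges to a finite limit. -/
def MutuallyStable (r : ℕ → ℝ) (x y : ℕ → X) : Prop :=
  ∃ L : ℝ, Tendsto (fun n => dist (x n) (y n) / r n) atTop (𝓝 L)

/-- A family of sequences is self-stable if any two members are mutually stable. -/
def SelfStable (r : ℕ → ℝ) (F : Set (ℕ → X)) : Prop :=
  ∀ x ∈ F, ∀ y ∈ F, MutuallyStable r x y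

/-- A maximal self-stable family containing the constant sequence `p`. -/
def MaximalSelfStable (p : X) (r : ℕ → ℝ) (F : Set (ℕ → X)) : Prop :=
  SelfStable r F ∧ (fun _ => p) ∈ F ∧
    ∀ G : Set (ℕ → X), SelfStable r G → F ⊆ G → G = F

/-- `(Ω, π)` is (a realization of) the pretangent space of `X` at `p`
with respect to the normalizing sequence `r` and the maximal self-stable family
`F`; the map `π` is the metric identification projection, so that the distance
in `Ω` between `π x` and `π y` is `lim_n d(x_n,y_n)/r_n`. -/
def IsPretangentSpace (p : X) (r : ℕ → ℝ) (F : Set (ℕ → X))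
    {Ω : Type u} [MetricSpace Ω] (π : (ℕ → X) → Ω) : Prop :=
  IsNormalizingSeq r ∧ MaximalSelfStable p r F ∧
    (∀ ω : Ω, ∃ x ∈ F, π x = ω) ∧
    ∀ x ∈ F, ∀ y ∈ F,
      Tendsto (fun n => dist (x n) (y n) / r n) atTop (𝓝 (dist (π x) (π y)))

/-- The pretangent space determined by the maximal self-stable family `F` is
tangent: for every strictly increasing sequence `φ` of naturals and every
maximal self-stable family `F'` w.r.t. `r ∘ φ` containing all `x ∘ φ` with
`x ∈ F`, the canonical isometric embedding `em'` is bijective (being always an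
isometric embedding it suffices that it be surjective, as stated here). -/
def IsTangentFamily (p : X) (r : ℕ → ℝ) (F : Set (ℕ → X)) : Prop :=
  ∀ φ : ℕ → ℕ, StrictMono φ →
    ∀ F' : Set (ℕ → X), MaximalSelfStable p (r ∘ φ) F' →
      (∀ x ∈ F, x ∘ φ ∈ F') →
      ∀ y ∈ F', ∃ x ∈ F,
        Tendsto (fun k => dist (x (φ k)) (y k) / r (φ k)) atTop (𝓝 0)

/-- `δ_p(w,x,y,z) = max_i d(x_i, p)`. -/
noncomputable def delta4 (p w x y z : X) : ℝ :=
  max (dist w p) (max (dist x p) (max (dist y p) (dist z p)))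

/-- `δ_p(x,y,z) = max_i d(x_i, p)`. -/
noncomputable def delta3 (p x y z : X) : ℝ :=
  max (dist x p) (max (dist y p) (dist z p))

open Classical in
/-- The function `A₁` of Berg–Nikolaev type. -/
noncomputable def A1 (p w x y z : X) : ℝ :=
  if w = p ∧ x = p ∧ y = p ∧ z = p then 0
  else (dist w x ^ 2 + dist x y ^ 2 + dist y z ^ 2 + dist z w ^ 2
          - dist w y ^ 2 - dist x z ^ 2) / delta4 p w x y z ^ 2

open Classical in
/-- The function `A₂` of Lebedeva–Petrunin type. -/
noncomputable def A2 (p w x y z : X) : ℝ :=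
  if w = p ∧ x = p ∧ y = p ∧ z = p then 0
  else (dist w x ^ 2 + dist w y ^ 2 + dist w z ^ 2
          - (dist x y ^ 2 + dist y z ^ 2 + dist z x ^ 2) / 3) / delta4 p w x y z ^ 2

open Classical in
/-- The function `A₃` of Ptolemy type. -/
noncomputable def A3 (p w x y z : X) : ℝ :=
  if w = p ∧ x = p ∧ y = p ∧ z = p then 0
  else (dist x w * dist y z + dist x z * dist y w - dist x y * dist w z)
          / delta4 p w x y z ^ 2

open Classical in
/-- The quotient `|d(w,z) - d(x,y)/2| / δ_p(x,y)`, valued in `EReal`, with the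
conventions: `0` if `x = y = p` and `z = p`, and `+∞` if `x = y = p` but `z ≠ p`. -/
noncomputable def midQuot (p w x y z : X) : EReal :=
  if x = p ∧ y = p then (if z = p then (0 : EReal) else ⊤)
  else ((|dist w z - dist x y / 2| / max (dist x p) (dist y p) : ℝ) : EReal)

/-- `z` is an infinitesimal midpoint of the sequences `x` and `y`. -/
def IsInfinitesimalMidpoint (p : X) (x y z : ℕ → X) : Prop :=
  Tendsto (fun n => midQuot p (x n) (x n) (y n) (z n)) atTop (𝓝 (0 : EReal)) ∧
    Tendsto (fun n => midQuot p (y n) (x n) (y n) (z n)) atTop (𝓝 (0 : EReal))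

/-- `X` is midpoint convex at the marked point `p`. -/
def MidpointConvexAt (p : X) : Prop :=
  ∀ x y : ℕ → X, Tendsto x atTop (𝓝 p) → Tendsto y atTop (𝓝 p) →
    ∃ z : ℕ → X, IsInfinitesimalMidpoint p x y z

/-- `X` is Busemann convex at the marked point `p`. -/
def BusemannConvexAt (p : X) : Prop :=
  MidpointConvexAt p ∧
    ∀ x0 x1 y m : ℕ → X, Tendsto x0 atTop (𝓝 p) → Tendsto x1 atTop (𝓝 p) →
      Tendsto y atTop (𝓝 p) → IsInfinitesimalMidpoint p x0 x1 m →
      Tendsto (fun n =>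
          max (dist (m n) (y n) - (dist (x0 n) (y n) + dist (x1 n) (y n)) / 2) 0
            / delta3 p (x0 n) (y n) (x1 n)) atTop (𝓝 (0 : ℝ))

end Defs

section MetricDefs

/-- `s` is a geodesic segment with endpoints `x` and `y`: a subset isometric to
the closed interval `[0, d(x,y)]`, the endpoints of the interval corresponding
to `x` and `y`. -/
def IsGeodesicSegment {Z : Type u} [MetricSpace Z] (s : Set Z) (x y : Z) : Prop :=
  ∃ f : ℝ → Z,
    (∀ a ∈ Set.Icc 0 (dist x y), ∀ b ∈ Set.Icc 0 (dist x y),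
      dist (f a) (f b) = |a - b|) ∧
    f '' Set.Icc 0 (dist x y) = s ∧ f 0 = x ∧ f (dist x y) = y

/-- A metric space is geodesic if any two points are the endpoints of some
geodesic segment. -/
def IsGeodesicSpace (Y : Type u) [MetricSpace Y] : Prop :=
  ∀ x y : Y, ∃ s : Set Y, IsGeodesicSegment s x y

/-- `m` is a midpoint of `x` and `y`. -/
def IsMidpointOf {Z : Type u} [MetricSpace Z] (m x y : Z) : Prop :=
  dist m x = dist x y / 2 ∧ dist m y = dist x y / 2

/-- An affinely parametrized geodesic `γ : [a,b] → Z`: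
`d(γ s, γ t) = λ |s - t|` for some constant `λ ≥ 0`. -/
def IsAffineGeodesic {Z : Type u} [MetricSpace Z] (γ : ℝ → Z) (a b : ℝ) : Prop :=
  ∃ lam : ℝ, 0 ≤ lam ∧ ∀ s ∈ Set.Icc a b, ∀ t ∈ Set.Icc a b,
    dist (γ s) (γ t) = lam * |s - t|

/-- Busemann convexity of a (geodesic) metric space: for any two affinely
parametrized geodesics the joint distance function is convex. -/
def BusemannConvex (Y : Type u) [MetricSpace Y] : Prop :=
  ∀ (a b a' b' : ℝ) (γ γ' : ℝ → Y), IsAffineGeodesic γ a b →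
    IsAffineGeodesic γ' a' b' →
    ConvexOn ℝ (Set.Icc a b ×ˢ Set.Icc a' b')
      (fun q : ℝ × ℝ => dist (γ q.1) (γ' q.2))

/-- A metric space is Ptolemaic if the Ptolemy inequality holds. -/
def Ptolemaic (Y : Type u) [MetricSpace Y] : Prop :=
  ∀ x y u v : Y, dist x y * dist u v ≤ dist x u * dist y v + dist x v * dist y u

end MetricDefs

section Geo
variable {Y : Type u} [MetricSpace Y]

/-- partial geodesics as graphs -/
def IsGraph (D : ℝ) (G : Set (ℝ × Y)) : Prop :=
  (∀ q ∈ G, 0 ≤ q.1 ∧ q.1 ≤ D) ∧ ∀ q ∈ G, ∀ q' ∈ G, dist q.2 q'.2 = |q.1 - q'.1|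

theorem IsGraph.closure {D : ℝ} {G : Set (ℝ × Y)} (h : IsGraph D G) : IsGraph D (closure G) := by
  constructor
  · intro q hq
    have hc : IsClosed {q : ℝ × Y | 0 ≤ q.1 ∧ q.1 ≤ D} :=
      (isClosed_le continuous_const continuous_fst).inter (isClosed_le continuous_fst continuous_const)
    exact (closure_minimal (fun q hq => h.1 q hq) hc) hq
  · have h1 : ∀ q ∈ G, ∀ q' ∈ _root_.closure G, dist q.2 q'.2 = |q.1 - q'.1| := by
      intro q hq q' hq'
      have hc : IsClosed {q' : ℝ × Y | dist q.2 q'.2 = |q.1 - q'.1|} :=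
        isClosed_eq (by fun_prop) (by fun_prop)
      exact (closure_minimal (fun q' hq' => h.2 q hq q' hq') hc) hq'
    intro q hq q' hq'
    have hc : IsClosed {q : ℝ × Y | dist q.2 q'.2 = |q.1 - q'.1|} :=
      isClosed_eq (by fun_prop) (by fun_prop)
    exact (closure_minimal (fun q hq => h1 q hq q' hq') hc) hq

theorem geodesic_of_mid (hp : ProperSpace Y)
    (hm : ∀ x y : Y, ∃ m, IsMidpointOf m x y) (x y : Y) :
    ∃ f : ℝ → Y, (∀ a ∈ Set.Icc 0 (dist x y), ∀ b ∈ Set.Icc 0 (dist x y),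
      dist (f a) (f b) = |a - b|) ∧ f 0 = x ∧ f (dist x y) = y := by
  set D := dist x y with hD
  have hD0 : 0 ≤ D := dist_nonneg
  let G0 : Set (ℝ × Y) := {(0, x), (D, y)}
  have hG0 : G0 ∈ {G : Set (ℝ × Y) | IsGraph D G} := by
    refine ⟨?_, ?_⟩
    · rintro q (rfl | rfl) <;> simp [hD0]
    · rintro q (rfl | rfl) q' (rfl | rfl) <;> simp [hD0, dist_comm, hD]
  obtain ⟨G, hGs, hmax⟩ := zorn_subset_nonempty {G : Set (ℝ × Y) | IsGraph D G} (by
    intro c hc hch _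
    refine ⟨⋃₀ c, ⟨?_, ?_⟩, fun s hs => Set.subset_sUnion_of_mem hs⟩
    · rintro q ⟨s, hs, hq⟩
      exact (hc hs).1 q hq
    · rintro q ⟨s, hs, hq⟩ q' ⟨s', hs', hq'⟩
      rcases hch.total hs hs' with h | h
      · exact (hc hs').2 q (h hq) q' hq'
      · exact (hc hs).2 q hq q' (h hq')) G0 hG0
  have hGg : IsGraph D G := hmax.prop
  have hcl : IsClosed G := by
    have := hmax.le_of_ge hGg.closure subset_closure
    exact isClosed_of_closure_subset this
  have h0 : ((0:ℝ), x) ∈ G := hGs (by simp [G0])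
  have h1 : (D, y) ∈ G := hGs (by simp [G0])
  have hcomp : IsCompact G := by
    refine (isCompact_Icc (a := (0:ℝ)) (b := D) |>.prod
      (isCompact_closedBall x D)).of_isClosed_subset hcl ?_
    intro q hq
    refine ⟨hGg.1 q hq, ?_⟩
    have := hGg.2 q hq _ h0
    simp only [sub_zero] at this
    rw [Metric.mem_closedBall, this, abs_of_nonneg (hGg.1 q hq).1]
    exact (hGg.1 q hq).2
  have hsurj : ∀ t ∈ Set.Icc 0 D, ∃ z, (t, z) ∈ G := by
    intro t ht
    by_contra hno
    push Not at hno
    have hL : IsCompact (G ∩ {q | q.1 ≤ t}) :=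
      hcomp.inter_right (isClosed_le continuous_fst continuous_const)
    have hR : IsCompact (G ∩ {q | t ≤ q.1}) :=
      hcomp.inter_right (isClosed_le continuous_const continuous_fst)
    obtain ⟨⟨a, za⟩, ⟨haG, hat⟩, hamax⟩ := hL.exists_isMaxOn ⟨_, h0, ht.1⟩
      (continuous_fst.continuousOn)
    obtain ⟨⟨b, zb⟩, ⟨hbG, hbt⟩, hbmin⟩ := hR.exists_isMinOn ⟨_, h1, ht.2⟩
      (continuous_fst.continuousOn)
    simp only [Set.mem_ofPred_eq] at hat hbt
    have hat' : a < t := lt_of_le_of_ne hat (by rintro rfl; exact hno _ haG)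
    have hbt' : t < b := lt_of_le_of_ne hbt (by rintro rfl; exact hno _ hbG)
    obtain ⟨m, hm1, hm2⟩ := hm za zb
    have hab := hGg.2 _ haG _ hbG
    simp only at hab
    rw [abs_of_neg (by linarith)] at hab
    have key : ∀ q ∈ G, dist q.2 m = |q.1 - (a+b)/2| := by
      rintro ⟨s, w⟩ hq
      have e1 := hGg.2 _ hq _ haG
      have e2 := hGg.2 _ hq _ hbG
      simp only at e1 e2 ⊢
      have hma := dist_triangle w za m
      have hmb := dist_triangle w zb m
      have hma' := dist_triangle w m za
      have hmb' := dist_triangle w m zb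
      rw [dist_comm m za] at *
      rw [dist_comm m zb] at *
      rcases le_total s t with hst | hst
      · have : s ≤ a := hamax ⟨hq, hst⟩
        rw [abs_of_nonpos (by linarith)] at e1 e2 ⊢
        linarith
      · have : b ≤ s := hbmin ⟨hq, hst⟩
        rw [abs_of_nonneg (by linarith)] at e1 e2 ⊢
        linarith
    have hbig : IsGraph D (insert ((a+b)/2, m) G) := by
      have ha1 := hGg.1 _ haG
      have hb1 := hGg.1 _ hbG
      simp only at ha1 hb1
      constructor
      · rintro q (rfl | hq)
        · constructor <;> simp only <;> linarith
        · exact hGg.1 q hq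
      · rintro q (rfl | hq) q' (rfl | hq')
        · simp
        · rw [dist_comm, key _ hq', abs_sub_comm]
        · exact key _ hq
        · exact hGg.2 _ hq _ hq'
    have hin := hmax.le_of_ge hbig (Set.subset_insert _ _) (Set.mem_insert _ _)
    rcases le_total ((a+b)/2) t with h | h
    · have := hamax ⟨hin, h⟩
      simp only [Set.mem_ofPred_eq] at this
      linarith
    · have := hbmin ⟨hin, h⟩
      simp only [Set.mem_ofPred_eq] at this
      linarith
  haveI : Nonempty Y := ⟨x⟩
  choose! f hf using hsurj
  refine ⟨f, ?_, ?_, ?_⟩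
  · intro a ha b hb
    exact hGg.2 _ (hf a ha) _ (hf b hb)
  · have := hGg.2 _ (hf 0 ⟨le_rfl, hD0⟩) _ h0
    simpa using this
  · have := hGg.2 _ (hf D ⟨hD0, le_rfl⟩) _ h1
    simpa using this

theorem ptol_between (hpt : Ptolemaic Y) (x y m z : Y) :
    dist m z * dist x y ≤ dist x z * dist m y + dist y z * dist x m := by
  have := hpt m z x y
  rw [dist_comm m x, dist_comm z x, dist_comm z y] at this
  linarith

end Geo

set_option linter.unusedSectionVars false

section Compact
variable {A : Type u} [MetricSpace A] [CompactSpace A]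

theorem packing_bound {ε : ℝ} (hε : 0 < ε) : ∃ N : ℕ, ∀ P : Finset A,
    (∀ a ∈ P, ∀ b ∈ P, a ≠ b → ε ≤ dist a b) → P.card ≤ N := by
  obtain ⟨t, _, htf, htc⟩ := finite_cover_balls_of_compact (isCompact_univ (X := A)) (half_pos hε)
  have hc : ∀ a : A, ∃ c ∈ t, dist a c < ε / 2 := by
    intro a
    have := htc (Set.mem_univ a)
    simpa using this
  choose f hf hfd using hc
  refine ⟨htf.toFinset.card, fun P hP => ?_⟩
  refine Finset.card_le_card_of_injOn f (fun a _ => by simpa using hf a) ?_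
  intro a ha b hb hab
  by_contra hne
  have h1 := hP a ha b hb hne
  have h2 := hfd a
  have h3 := hfd b
  have h4 := dist_triangle_right a b (f a)
  have hab' : f a = f b := hab
  rw [← hab'] at h3
  linarith

theorem iter_nc {f : A → A} (hf : ∀ x y, dist x y ≤ dist (f x) (f y)) (n : ℕ) (x y : A) :
    dist x y ≤ dist (f^[n] x) (f^[n] y) := by
  induction n generalizing x y with
  | zero => simp
  | succ n ih => exact (hf x y).trans (by simpa using ih (f x) (f y))

theorem recur_nc {f : A → A} (hf : ∀ x y, dist x y ≤ dist (f x) (f y)) (x y : A) {ε : ℝ}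
    (hε : 0 < ε) : ∃ k, dist x (f^[k+1] x) < ε ∧ dist y (f^[k+1] y) < ε := by
  obtain ⟨a, φ, hφ, ha⟩ := CompactSpace.tendsto_subseq (fun n => ((f^[n] x, f^[n] y) : A × A))
  have hc := ha.cauchySeq
  rw [Metric.cauchySeq_iff] at hc
  obtain ⟨N, hN⟩ := hc ε hε
  have h := hN N le_rfl (N+1) (by omega)
  have hlt : φ N < φ (N+1) := hφ (by omega)
  obtain ⟨k, hk⟩ := Nat.exists_eq_add_of_lt hlt
  rw [Prod.dist_eq, max_lt_iff] at h
  simp only [Function.comp] at h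
  rw [hk, show φ N + k + 1 = φ N + (k+1) by ring, Function.iterate_add_apply,
    Function.iterate_add_apply f (φ N) (k+1) y] at h
  exact ⟨k, (iter_nc hf _ _ _).trans_lt h.1, (iter_nc hf _ _ _).trans_lt h.2⟩

theorem isom_of_nc {f : A → A} (hf : ∀ x y, dist x y ≤ dist (f x) (f y)) (x y : A) :
    dist (f x) (f y) = dist x y := by
  refine le_antisymm (le_of_forall_pos_le_add fun ε hε => ?_) (hf x y)
  obtain ⟨k, h1, h2⟩ := recur_nc hf x y (half_pos hε)
  have h3 := iter_nc hf k (f x) (f y)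
  simp only [← Function.iterate_succ_apply] at h3
  have h4 := dist_triangle4 (f^[k+1] x) x y (f^[k+1] y)
  rw [dist_comm _ x] at h4
  simp only [Nat.succ_eq_add_one] at h3
  linarith

theorem sep_grow {σ : A → A} {ε t' : ℝ} (Q : ℝ → Prop) (hQ : ∀ d, d ≤ t' → Q d) (hε : 0 < ε) (hA : Nonempty A)
    (hsep : ∀ a b : A, ε ≤ dist a b → ε ≤ dist (σ a) (σ b))
    (hball : ∀ z a : A, Q (dist z a) → dist (σ z) (σ a) ≤ t')
    (hadd : ∀ z : A, ∃ w, Q (dist z w) ∧ t' + ε ≤ dist z w) : False := by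
  classical
  have key : ∀ n : ℕ, ∃ (z : A) (P : Finset A), P.card = n ∧ (∀ a ∈ P, Q (dist z a)) ∧
      ∀ a ∈ P, ∀ b ∈ P, a ≠ b → ε ≤ dist a b := by
    intro n
    induction n with
    | zero => exact ⟨hA.some, ∅, by simp⟩
    | succ n ih =>
      obtain ⟨z, P, hc, hb, hs⟩ := ih
      obtain ⟨w, hw1, hw2⟩ := hadd (σ z)
      have hinj : Set.InjOn σ P := by
        intro a ha b hb' hab
        by_contra hne
        have := hsep a b (hs a ha b hb' hne)
        rw [hab, dist_self] at this
        linarith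
      have hwP : ∀ a ∈ P, ε ≤ dist w (σ a) := by
        intro a ha
        have h1 := hball z a (hb a ha)
        have h2 := dist_triangle_right (σ z) w (σ a)
        linarith
      have hnot : w ∉ P.image σ := by
        intro hw
        obtain ⟨a, ha, rfl⟩ := Finset.mem_image.1 hw
        have := hwP a ha
        rw [dist_self] at this
        linarith
      refine ⟨σ z, insert w (P.image σ), ?_, ?_, ?_⟩
      · rw [Finset.card_insert_of_notMem hnot, Finset.card_image_of_injOn hinj, hc]
      · intro a ha
        rcases Finset.mem_insert.1 ha with rfl | ha
        · exact hw1
        · obtain ⟨b, hb', rfl⟩ := Finset.mem_image.1 ha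
          exact hQ _ (hball z b (hb b hb'))
      · intro a ha b hb' hne
        rcases Finset.mem_insert.1 ha with ha1 | ha1
        · rcases Finset.mem_insert.1 hb' with hb1 | hb1
          · exact absurd (ha1.trans hb1.symm) hne
          · obtain ⟨b2, hb2, rfl⟩ := Finset.mem_image.1 hb1
            rw [ha1]
            exact hwP b2 hb2
        · obtain ⟨a2, ha2, rfl⟩ := Finset.mem_image.1 ha1
          rcases Finset.mem_insert.1 hb' with hb1 | hb1
          · rw [dist_comm, hb1]; exact hwP a2 ha2
          · obtain ⟨b2, hb2, rfl⟩ := Finset.mem_image.1 hb1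
            exact hsep a2 b2 (hs a2 ha2 b2 hb2 (by rintro rfl; exact hne rfl))
  obtain ⟨N, hN⟩ := packing_bound (A := A) hε
  obtain ⟨z, P, hc, -, hs⟩ := key (N+1)
  have := hN P hs
  omega

theorem isom_of_order {σ : A → A} (hsur : Function.Surjective σ)
    (hord : ∀ x y x' y', dist x y ≤ dist x' y' → dist (σ x) (σ y) ≤ dist (σ x') (σ y'))
    (htr : ∀ x y z : A, ∃ w, dist z w = dist x y)
    (hiv : ∀ x y D, dist x y ≤ D → D ≤ dist (σ x) (σ y) → ∃ u v : A, dist u v = D)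
    (x y : A) : dist (σ x) (σ y) = dist x y := by
  by_cases hA : ∀ η > 0, ∃ x y : A, 0 < dist x y ∧ dist x y < η ∧ dist x y ≤ dist (σ x) (σ y)
  · refine isom_of_nc (fun x y => ?_) x y
    by_contra hlt
    push Not at hlt
    -- t' = d(σx,σy) < t = d(x,y)
    obtain ⟨a, b, h0, h1, h2⟩ := hA (dist x y - dist (σ x) (σ y)) (by linarith)
    refine sep_grow (σ := σ) (ε := dist a b) (t' := dist (σ x) (σ y)) (fun d => d ≤ dist x y)
        (fun d hd => by linarith) h0 ⟨x⟩ ?_ ?_ ?_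
    · intro u v huv
      exact h2.trans (hord _ _ _ _ huv)
    · intro z u hzu
      exact hord _ _ _ _ hzu
    · intro z
      obtain ⟨w, hw⟩ := htr x y z
      exact ⟨w, hw.le, by linarith⟩
  · push Not at hA
    obtain ⟨η, hη, hB⟩ := hA
    have hle : ∀ x y, dist (σ x) (σ y) ≤ dist x y := by
      intro x y
      by_contra hlt
      push Not at hlt
      choose τ hτ using hsur
      set t0 := dist x y with ht0
      set t2 := dist (σ x) (σ y) with ht2
      set ε := min (η/2) ((t2-t0)/2) with hε
      have hε1 : ε ≤ η/2 := min_le_left _ _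
      have hε2 : ε ≤ (t2-t0)/2 := min_le_right _ _
      have hε0 : 0 < ε := lt_min (by linarith) (by linarith)
      refine sep_grow (σ := τ) (ε := ε) (t' := t0) (fun d => d < t2)
        (fun d hd => by linarith) hε0 ⟨x⟩ ?_ ?_ ?_
      · intro a b hab
        by_contra hh
        push Not at hh
        have hpos : 0 < dist (τ a) (τ b) := by
          rw [dist_pos]; intro h
          have : a = b := by rw [← hτ a, ← hτ b, h]
          rw [this, dist_self] at hab
          linarith
        have := hB _ _ hpos (by linarith)
        rw [hτ, hτ] at this
        linarith
      · intro z a hza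
        by_contra hh
        push Not at hh
        have := hord x y _ _ hh.le
        rw [hτ, hτ] at this
        linarith
      · intro z
        obtain ⟨u, v, huv⟩ := hiv x y ((t0+t2)/2) (by linarith) (by linarith)
        obtain ⟨w, hw⟩ := htr u v z
        exact ⟨w, by linarith, by linarith⟩
    choose τ hτ using hsur
    have hnc : ∀ a b, dist a b ≤ dist (τ a) (τ b) := fun a b => by
      have := hle (τ a) (τ b); rwa [hτ, hτ] at this
    refine le_antisymm (hle x y) (le_of_forall_pos_le_add fun ε hε => ?_)
    obtain ⟨k, h1, h2⟩ := recur_nc hnc x y (show 0 < ε/4 by linarith)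
    rw [Function.iterate_succ_apply'] at h1 h2
    set x' := τ^[k] x
    set y' := τ^[k] y
    have e := isom_of_nc hnc x' y'
    have h3 := hle x (τ x')
    have h4 := hle y (τ y')
    rw [hτ] at h3 h4
    have h5 := dist_triangle4 x (τ x') (τ y') y
    have h6 := dist_triangle4 x' (σ x) (σ y) y'
    rw [dist_comm (τ y') y] at h5
    rw [dist_comm x' (σ x)] at h6
    linarith

end Compact

structure Good (Y : Type u) [MetricSpace Y] (o : Y) : Prop where
  proper : ProperSpace Y
  ptol : Ptolemaic Y
  mid : ∀ x y : Y, ∃ m, IsMidpointOf m x y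
  hom : ∀ c : ℝ, 0 < c → ∀ a a' : Fin 3 → Y,
    (∀ i j, dist (a' i) (a' j) = c * dist (a i) (a j)) →
    (∀ i, dist o (a' i) = c * dist o (a i)) →
    ∃ h : Y → Y, Function.Surjective h ∧ (∀ u v, dist (h u) (h v) = c * dist u v) ∧
      h o = o ∧ ∀ i, h (a i) = a' i

/-- similarity fixing `o` -/
structure Sim {Y : Type u} [MetricSpace Y] (o : Y) (c : ℝ) (h : Y → Y) : Prop where
  sur : Function.Surjective h
  dst : ∀ u v, dist (h u) (h v) = c * dist u v
  fix : h o = o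

namespace Good
variable {Y : Type u} [MetricSpace Y] {o : Y}

theorem _root_.Sim.nrm {c : ℝ} {h : Y → Y} (s : Sim o c h) (x : Y) :
    dist o (h x) = c * dist o x := by
  rw [← s.dst, s.fix]

theorem hom3 (H : Good Y o) {c : ℝ} (hc : 0 < c) {x y z x' y' z' : Y}
    (hx : dist o x' = c * dist o x) (hy : dist o y' = c * dist o y)
    (hz : dist o z' = c * dist o z) (hxy : dist x' y' = c * dist x y)
    (hxz : dist x' z' = c * dist x z) (hyz : dist y' z' = c * dist y z) :
    ∃ h : Y → Y, Sim o c h ∧ h x = x' ∧ h y = y' ∧ h z = z' := by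
  obtain ⟨h, h1, h2, h3, h4⟩ := H.hom c hc ![x, y, z] ![x', y', z'] (by
    intro i j
    fin_cases i <;> fin_cases j <;> simp [dist_comm, *] <;>
      simp [dist_comm y x, dist_comm z x, dist_comm z y, dist_comm y' x', dist_comm z' x',
        dist_comm z' y', *]) (by
    intro i
    fin_cases i <;> simp [*])
  exact ⟨h, ⟨h1, h2, h3⟩, h4 0, h4 1, h4 2⟩

theorem hom2 (H : Good Y o) {c : ℝ} (hc : 0 < c) {x y x' y' : Y}
    (hx : dist o x' = c * dist o x) (hy : dist o y' = c * dist o y)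
    (hxy : dist x' y' = c * dist x y) :
    ∃ h : Y → Y, Sim o c h ∧ h x = x' ∧ h y = y' := by
  obtain ⟨h, h1, h2, h3, -⟩ := H.hom3 hc hx hy hy hxy hxy (by simp)
  exact ⟨h, h1, h2, h3⟩

theorem hom1 (H : Good Y o) {c : ℝ} (hc : 0 < c) {x x' : Y}
    (hx : dist o x' = c * dist o x) :
    ∃ h : Y → Y, Sim o c h ∧ h x = x' := by
  obtain ⟨h, h1, h2, -⟩ := H.hom2 hc hx hx (by simp)
  exact ⟨h, h1, h2⟩

theorem mid_le (H : Good Y o) {m x y : Y} (hm : IsMidpointOf m x y) (z : Y) :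
    dist m z ≤ (dist x z + dist y z) / 2 := by
  rcases eq_or_ne x y with rfl | hne
  · have : m = x := by have := hm.1; rw [dist_self, zero_div] at this; exact dist_eq_zero.1 this
    rw [this]; linarith
  have hpos := dist_pos.2 hne
  have := ptol_between H.ptol x y m z
  rw [hm.2, dist_comm x m, hm.1] at this
  nlinarith

theorem subsing (H : Good Y o) {M : Set Y} (hM : IsCompact M)
    (hmid : ∀ x ∈ M, ∀ y ∈ M, ∀ m, IsMidpointOf m x y → m ∈ M)
    (htr : ∀ x ∈ M, ∀ y ∈ M, ∃ g : Y → Y, (∀ u v, dist (g u) (g v) = dist u v) ∧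
      (∀ u ∈ M, g u ∈ M) ∧ g x = y) : M.Subsingleton := by
  by_contra hns
  rw [Set.not_subsingleton_iff] at hns
  obtain ⟨a0, ha0, b0, hb0, hab0⟩ := hns
  obtain ⟨⟨a, b⟩, ⟨ha, hb⟩, hmax⟩ := (hM.prod hM).exists_isMaxOn (f := fun q : Y × Y => dist q.1 q.2)
    ⟨(a0, b0), ha0, hb0⟩ (by fun_prop)
  set δ := dist a b with hδ
  have hδmax : ∀ x ∈ M, ∀ y ∈ M, dist x y ≤ δ := fun x hx y hy => hmax (a := (x,y)) ⟨hx, hy⟩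
  have hδ0 : 0 < δ := (dist_pos.2 hab0).trans_le (hδmax _ ha0 _ hb0)
  have hfar : ∀ z : Y, ∃ w : Y, z ∈ M → w ∈ M ∧ dist z w = δ := by
    intro z
    by_cases hz : z ∈ M
    · obtain ⟨g, hg, hgM, hga⟩ := htr a ha z hz
      exact ⟨g b, fun _ => ⟨hgM b hb, by rw [← hga, hg]⟩⟩
    · exact ⟨z, fun h => absurd h hz⟩
  choose far hfar using hfar
  choose md hmd using H.mid
  let z : ℕ → Y := fun n => Nat.rec a (fun _ z => md z (far z)) n
  have hz : ∀ n, z (n+1) = md (z n) (far (z n)) := fun n => rfl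
  have hzM : ∀ n, z n ∈ M := by
    intro n
    induction n with
    | zero => exact ha
    | succ n ih => rw [hz]; exact hmid _ ih _ (hfar _ ih).1 _ (hmd _ _)
  have key : ∀ j k, dist (z k) (far (z (k+j))) = δ := by
    intro j
    induction j with
    | zero => intro k; exact (hfar _ (hzM k)).2
    | succ j ih =>
      intro k
      have h1 := ih (k+1)
      rw [show k + 1 + j = k + (j+1) by ring] at h1
      have h2 := H.mid_le (hmd (z k) (far (z k))) (far (z (k+(j+1))))
      rw [← hz, h1] at h2
      have h3 := hδmax _ (hzM k) _ (hfar _ (hzM (k+(j+1)))).1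
      have h4 := hδmax _ (hfar _ (hzM k)).1 _ (hfar _ (hzM (k+(j+1)))).1
      linarith
  have key2 : ∀ j k, dist (far (z k)) (far (z (k+j+1))) = δ := by
    intro j k
    have h1 := key j (k+1)
    rw [show k + 1 + j = k + j + 1 by ring] at h1
    have h2 := H.mid_le (hmd (z k) (far (z k))) (far (z (k+j+1)))
    rw [← hz, h1] at h2
    have h3 := hδmax _ (hzM k) _ (hfar _ (hzM (k+j+1))).1
    have h4 := hδmax _ (hfar _ (hzM k)).1 _ (hfar _ (hzM (k+j+1))).1
    linarith
  obtain ⟨l, -, φ, hφ, hl⟩ := hM.tendsto_subseq (x := fun n => far (z n)) (fun n => (hfar _ (hzM n)).1)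
  have hc := hl.cauchySeq
  rw [Metric.cauchySeq_iff] at hc
  obtain ⟨N, hN⟩ := hc δ hδ0
  have h := hN N le_rfl (N+1) (by omega)
  obtain ⟨k, hk⟩ := Nat.exists_eq_add_of_lt (hφ (show N < N+1 by omega))
  simp only [Function.comp] at h
  rw [hk, key2] at h
  exact lt_irrefl _ h

theorem rd_subsing (H : Good Y o) {t : ℝ} (x : Y) :
    {z | dist o z = t * dist o x ∧ dist z x = (1-t) * dist o x}.Subsingleton := by
  haveI := H.proper
  refine H.subsing ?_ ?_ ?_
  · refine (isCompact_closedBall o (t * dist o x)).of_isClosed_subset ?_ ?_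
    · exact (isClosed_eq (by fun_prop) (by fun_prop)).inter (isClosed_eq (by fun_prop) (by fun_prop))
    · intro z hz
      rw [Metric.mem_closedBall, dist_comm]
      exact hz.1.le
  · rintro z ⟨hz1, hz2⟩ w ⟨hw1, hw2⟩ m hm
    have h1 := H.mid_le hm o
    have h2 := H.mid_le hm x
    rw [dist_comm z, dist_comm w, dist_comm m] at h1
    have h3 := dist_triangle o m x
    constructor <;> linarith
  · rintro z ⟨hz1, hz2⟩ w ⟨hw1, hw2⟩
    obtain ⟨h, hs, hx, hzw⟩ := H.hom2 (c := 1) one_pos (x := x) (y := z) (x' := x) (y' := w)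
      (by ring) (by rw [hz1, hw1]; ring) (by rw [dist_comm, hw2, dist_comm x, hz2]; ring)
    refine ⟨h, fun u v => by rw [hs.dst, one_mul], ?_, hzw⟩
    rintro u ⟨hu1, hu2⟩
    refine ⟨by rw [hs.nrm, hu1]; ring, ?_⟩
    nth_rewrite 1 [← hx]
    rw [hs.dst, hu2]; ring

theorem rd_exists (H : Good Y o) {t : ℝ} (ht0 : 0 ≤ t) (ht1 : t ≤ 1) (x : Y) :
    ∃ z, dist o z = t * dist o x ∧ dist z x = (1-t) * dist o x := by
  obtain ⟨f, hf, h0, h1⟩ := geodesic_of_mid H.proper H.mid o x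
  have hD : 0 ≤ dist o x := dist_nonneg
  have ht : t * dist o x ∈ Set.Icc 0 (dist o x) := ⟨by positivity, by nlinarith⟩
  refine ⟨f (t * dist o x), ?_, ?_⟩
  · have := hf 0 ⟨le_rfl, hD⟩ _ ht
    rw [h0, zero_sub, abs_neg, abs_of_nonneg ht.1] at this
    exact this
  · have := hf _ ht _ ⟨hD, le_rfl⟩
    rw [h1, abs_of_nonpos (by linarith [ht.2])] at this
    linarith

open Classical in
/-- the point at ratio `t` on the segment from `o` to `x` -/
noncomputable def rd (o : Y) (t : ℝ) (x : Y) : Y :=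
  if h : ∃ z, dist o z = t * dist o x ∧ dist z x = (1-t) * dist o x then h.choose else o

theorem rd_spec (H : Good Y o) {t : ℝ} (ht0 : 0 ≤ t) (ht1 : t ≤ 1) (x : Y) :
    dist o (rd o t x) = t * dist o x ∧ dist (rd o t x) x = (1-t) * dist o x := by
  have h := H.rd_exists ht0 ht1 x
  unfold rd
  rw [dif_pos h]
  exact h.choose_spec

theorem rd_uniq (H : Good Y o) {t : ℝ} (ht0 : 0 ≤ t) (ht1 : t ≤ 1) {x z : Y}
    (h1 : dist o z = t * dist o x) (h2 : dist z x = (1-t) * dist o x) : rd o t x = z :=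
  H.rd_subsing x (H.rd_spec ht0 ht1 x) ⟨h1, h2⟩

theorem rd_one (H : Good Y o) (x : Y) : rd o 1 x = x :=
  H.rd_uniq zero_le_one le_rfl (by ring) (by simp)

theorem rd_zero (H : Good Y o) (x : Y) : rd o 0 x = o :=
  H.rd_uniq le_rfl zero_le_one (by simp) (by simp)

theorem rd_rd (H : Good Y o) {s t : ℝ} (hs0 : 0 ≤ s) (hs1 : s ≤ 1) (ht0 : 0 ≤ t) (ht1 : t ≤ 1)
    (x : Y) : rd o s (rd o t x) = rd o (s*t) x := by
  obtain ⟨a1, a2⟩ := H.rd_spec ht0 ht1 x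
  obtain ⟨b1, b2⟩ := H.rd_spec hs0 hs1 (rd o t x)
  symm
  have e1 : dist o (rd o s (rd o t x)) = (s*t) * dist o x := by rw [b1, a1]; ring
  refine H.rd_uniq (by positivity) (by nlinarith) e1 ?_
  have h3 := dist_triangle o (rd o s (rd o t x)) x
  have h4 := dist_triangle (rd o s (rd o t x)) (rd o t x) x
  rw [b2, a1, a2] at h4
  linarith

theorem rd_dist (H : Good Y o) {s t : ℝ} (hs0 : 0 ≤ s) (hs1 : s ≤ 1) (ht0 : 0 ≤ t) (ht1 : t ≤ 1)
    (x : Y) : dist (rd o s x) (rd o t x) = |s - t| * dist o x := by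
  wlog hst : s ≤ t generalizing s t
  · rw [dist_comm, this ht0 ht1 hs0 hs1 (by linarith), abs_sub_comm]
  rcases eq_or_lt_of_le ht0 with rfl | htp
  · have : s = 0 := by linarith
    subst this; simp
  have e : rd o s x = rd o (s/t) (rd o t x) := by
    rw [H.rd_rd (by positivity) ((div_le_one htp).2 hst) ht0 ht1]
    congr 1; field_simp
  rw [e, (H.rd_spec (by positivity) ((div_le_one htp).2 hst) _).2, (H.rd_spec ht0 ht1 x).1,
    abs_of_nonpos (by linarith)]
  field_simp; ring

theorem rd_sim (H : Good Y o) {c t : ℝ} {h : Y → Y} (hs : Sim o c h)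
    (ht0 : 0 ≤ t) (ht1 : t ≤ 1) (x : Y) : rd o t (h x) = h (rd o t x) := by
  obtain ⟨a1, a2⟩ := H.rd_spec ht0 ht1 x
  refine H.rd_uniq ht0 ht1 ?_ ?_
  · rw [hs.nrm, hs.nrm, a1]; ring
  · rw [hs.dst, hs.nrm, a2]; ring

theorem rd_cont (H : Good Y o) (x : Y) : ContinuousOn (fun t => rd o t x) (Set.Icc 0 1) := by
  have : LipschitzOnWith (Real.toNNReal (dist o x)) (fun t => rd o t x) (Set.Icc 0 1) := by
    refine LipschitzOnWith.of_dist_le_mul fun s hs t ht => ?_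
    rw [H.rd_dist hs.1 hs.2 ht.1 ht.2, Real.dist_eq, Real.coe_toNNReal _ dist_nonneg, mul_comm]
  exact this.continuousOn

/-- outward extension -/
theorem rd_out (H : Good Y o) {t : ℝ} (ht0 : 0 < t) (ht1 : t ≤ 1) (x : Y) :
    ∃ y, rd o t y = x := by
  obtain ⟨h, hs, hx⟩ := H.hom1 (c := t⁻¹) (by positivity) (x := rd o t x) (x' := x)
    (by rw [(H.rd_spec ht0.le ht1 x).1]; field_simp)
  exact ⟨h x, by rw [H.rd_sim hs ht0.le ht1, hx]⟩

end Good

namespace Good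
variable {Y : Type u} [MetricSpace Y] {o : Y}

theorem rd_dcont (H : Good Y o) (x y : Y) :
    ContinuousOn (fun t => dist (rd o t x) (rd o t y)) (Set.Icc 0 1) :=
  continuous_dist.comp_continuousOn ((H.rd_cont x).prodMk (H.rd_cont y))

theorem rd_ord (H : Good Y o) {c : ℝ} (hc0 : 0 ≤ c) (hc1 : c ≤ 1) {x y x' y' : Y}
    (hx : dist o x' = dist o x) (hy : dist o y' = dist o y) (hd : dist x y ≤ dist x' y') :
    dist (rd o c x) (rd o c y) ≤ dist (rd o c x') (rd o c y') := by
  by_contra hlt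
  push Not at hlt
  have hcont : ContinuousOn (fun t => dist (rd o t x') (rd o t y') - dist (rd o t x) (rd o t y))
      (Set.Icc c 1) :=
    ((H.rd_dcont x' y').sub (H.rd_dcont x y)).mono (Set.Icc_subset_Icc_left hc0)
  have h0 : (0:ℝ) ∈ Set.Icc (dist (rd o c x') (rd o c y') - dist (rd o c x) (rd o c y))
     (dist (rd o 1 x') (rd o 1 y') - dist (rd o 1 x) (rd o 1 y)) := by
    constructor
    · linarith
    · simp only [H.rd_one]; linarith
  obtain ⟨s, hs, hs0⟩ := intermediate_value_Icc hc1 hcont h0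
  simp only at hs0
  rcases eq_or_lt_of_le (hc0.trans hs.1) with rfl | hsp
  · have : c = 0 := by linarith [hs.1]
    subst this
    simp [H.rd_zero] at hlt
  have n1 := fun x => (H.rd_spec hsp.le hs.2 x).1
  obtain ⟨h, hsim, h1, h2⟩ := H.hom2 (c := 1) one_pos (x := rd o s x) (y := rd o s y)
    (x' := rd o s x') (y' := rd o s y') (by rw [n1, n1, hx]; ring) (by rw [n1, n1, hy]; ring)
    (by linarith)
  have e : ∀ x, rd o (c/s) (rd o s x) = rd o c x := fun x => by
    rw [H.rd_rd (by positivity) ((div_le_one hsp).2 hs.1) hsp.le hs.2]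
    congr 1; field_simp
  have q0 : 0 ≤ c/s := by positivity
  have q1 : c/s ≤ 1 := (div_le_one hsp).2 hs.1
  rw [← e x', ← e y', ← h1, ← h2, H.rd_sim hsim q0 q1, H.rd_sim hsim q0 q1, hsim.dst, e, e] at hlt
  linarith

theorem rd_conic_sphere (H : Good Y o) {c : ℝ} (hc0 : 0 < c) (hc1 : c ≤ 1) {x y : Y}
    (hxy : dist o x = dist o y) :
    dist (rd o c x) (rd o c y) = c * dist x y := by
  set ℓ := dist o x with hℓ
  obtain ⟨h, hsim, -⟩ := H.hom1 (c := c) hc0 (x := o) (x' := o) (by simp)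
  let A := {z : Y // dist o z = ℓ}
  haveI : CompactSpace A := by
    haveI := H.proper
    refine (isCompact_iff_compactSpace (s := {z : Y | dist o z = ℓ})).1 ?_
    refine (isCompact_closedBall o ℓ).of_isClosed_subset
      (isClosed_eq (by fun_prop) (by fun_prop)) ?_
    intro z hz
    rw [Metric.mem_closedBall, dist_comm]
    exact le_of_eq hz
  have hex : ∀ z : A, ∃ w : A, h w.1 = rd o c z.1 := by
    intro z
    obtain ⟨w, hw⟩ := hsim.sur (rd o c z.1)
    refine ⟨⟨w, ?_⟩, hw⟩
    have h1 := hsim.nrm w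
    rw [hw, (H.rd_spec hc0.le hc1 z.1).1, z.2] at h1
    exact (mul_left_cancel₀ hc0.ne' h1).symm
  choose σ hσ using hex
  have hσd : ∀ a b : A, c * dist (σ a) (σ b) = dist (rd o c a.1) (rd o c b.1) := by
    intro a b
    rw [← hσ, ← hσ, hsim.dst]; rfl
  have hiso := isom_of_order (A := A) (σ := σ) ?_ ?_ ?_ ?_ ⟨x, rfl⟩ ⟨y, hxy.symm⟩
  · have := hσd ⟨x, rfl⟩ ⟨y, hxy.symm⟩
    rw [hiso] at this
    exact this.symm
  · rintro ⟨b, hb⟩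
    obtain ⟨a, ha⟩ := H.rd_out hc0 hc1 (h b)
    have hn := (H.rd_spec hc0.le hc1 a).1
    rw [ha, hsim.nrm] at hn
    have hn' := mul_left_cancel₀ hc0.ne' hn
    refine ⟨⟨a, by rw [← hn', hb]⟩, ?_⟩
    have h1 := hσ ⟨a, by rw [← hn', hb]⟩
    simp only [ha] at h1
    have h2 := hsim.dst (σ ⟨a, by rw [← hn', hb]⟩).1 b
    rw [h1, dist_self] at h2
    have h3 : dist (σ ⟨a, by rw [← hn', hb]⟩).1 b = 0 := by
      rcases mul_eq_zero.1 h2.symm with h | h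
      · exact absurd h hc0.ne'
      · exact h
    exact Subtype.ext (dist_eq_zero.1 h3)
  · intro a b a' b' hab
    have h1 := H.rd_ord hc0.le hc1 (x := a.1) (y := b.1) (x' := a'.1) (y' := b'.1)
      (by rw [a.2, a'.2]) (by rw [b.2, b'.2]) hab
    rw [← hσd, ← hσd] at h1
    exact le_of_mul_le_mul_left h1 hc0
  · intro a b z
    obtain ⟨g, hg, hga⟩ := H.hom1 (c := 1) one_pos (x := a.1) (x' := z.1) (by rw [a.2, z.2]; ring)
    refine ⟨⟨g b.1, by rw [hg.nrm, b.2, one_mul]⟩, ?_⟩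
    change dist z.1 (g b.1) = dist a.1 b.1
    rw [← hga, hg.dst, one_mul]
  · intro a b D h1 h2
    have hcont : ContinuousOn (fun s => dist (rd o s a.1) (rd o s b.1) / s) (Set.Icc c 1) := by
      refine ((H.rd_dcont a.1 b.1).mono (Set.Icc_subset_Icc_left hc0.le)).div continuousOn_id ?_
      intro s hs
      have := hs.1
      exact (hc0.trans_le this).ne'
    have hD : D ∈ Set.Icc (dist (rd o 1 a.1) (rd o 1 b.1) / 1)
        (dist (rd o c a.1) (rd o c b.1) / c) := by
      rw [H.rd_one, H.rd_one, div_one, ← hσd]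
      refine ⟨h1, h2.trans (le_of_eq ?_)⟩
      field_simp
    obtain ⟨s, hs, hsD⟩ := intermediate_value_Icc' hc1 hcont hD
    simp only at hsD
    have hsp : 0 < s := hc0.trans_le hs.1
    have n1 := fun x => (H.rd_spec hsp.le hs.2 x).1
    obtain ⟨g, hg, hga⟩ := H.hom1 (c := s⁻¹) (by positivity) (x := rd o s a.1) (x' := a.1)
      (by rw [n1]; field_simp)
    refine ⟨a, ⟨g (rd o s b.1), by rw [hg.nrm, n1, b.2]; field_simp⟩, ?_⟩
    change dist a.1 (g (rd o s b.1)) = D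
    nth_rewrite 1 [← hga]
    rw [hg.dst, ← hsD]
    field_simp

theorem rd_conic (H : Good Y o) {c : ℝ} (hc0 : 0 ≤ c) (hc1 : c ≤ 1) (x y : Y) :
    dist (rd o c x) (rd o c y) = c * dist x y := by
  rcases eq_or_lt_of_le hc0 with rfl | hc
  · simp [H.rd_zero]
  wlog hxy : dist o x ≤ dist o y generalizing x y
  · rw [dist_comm, this y x (by linarith), dist_comm]
  rcases eq_or_ne o x with rfl | hox
  · have : rd o c o = o := H.rd_uniq hc0 hc1 (by simp) (by simp)
    rw [this, (H.rd_spec hc0 hc1 y).1]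
  have hx0 := dist_pos.2 hox
  have hy0 : 0 < dist o y := by linarith
  set s := dist o x / dist o y with hs
  have hs0 : 0 < s := by positivity
  have hs1 : s ≤ 1 := (div_le_one hy0).2 hxy
  obtain ⟨X, hX⟩ := H.rd_out hs0 hs1 x
  have hXn : dist o X = dist o y := by
    have h1 := (H.rd_spec hs0.le hs1 X).1
    rw [hX, hs] at h1
    field_simp at h1
    linarith
  have n1 := fun x => (H.rd_spec hc.le hc1 x).1
  obtain ⟨g, hg, hga, hgb⟩ := H.hom2 (c := c) hc (x := X) (y := y) (x' := rd o c X) (y' := rd o c y)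
    (n1 _) (n1 _) (H.rd_conic_sphere hc hc1 hXn)
  have e : g x = rd o c x := by
    rw [← hX, ← H.rd_sim hg hs0.le hs1, hga, H.rd_rd hs0.le hs1 hc0 hc1,
      H.rd_rd hc0 hc1 hs0.le hs1, mul_comm]
  rw [← e, ← hgb, hg.dst]

open Classical in
/-- scaling -/
noncomputable def sm (o : Y) (t : ℝ) (x : Y) : Y :=
  if t ≤ 1 then rd o t x else if h : ∃ y, rd o t⁻¹ y = x then h.choose else o

theorem rd_sm (H : Good Y o) {s t : ℝ} (hs0 : 0 ≤ s) (hs1 : s ≤ 1) (ht : 0 ≤ t) (hst : s*t ≤ 1)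
    (x : Y) : rd o s (sm o t x) = rd o (s*t) x := by
  unfold sm
  split_ifs with h1 h2
  · exact H.rd_rd hs0 hs1 ht h1 x
  · have h3 := h2.choose_spec
    push Not at h1
    have hi : t⁻¹ ≤ 1 := inv_le_one_of_one_le₀ h1.le
    conv_rhs => rw [← h3]
    rw [H.rd_rd (by positivity) hst (by positivity) hi]
    congr 1
    have : t ≠ 0 := by linarith
    field_simp
  · push Not at h1
    exact absurd (H.rd_out (by positivity) (inv_le_one_of_one_le₀ h1.le) x) h2

theorem rd_inj (H : Good Y o) {c : ℝ} (hc0 : 0 < c) (hc1 : c ≤ 1) {x y : Y}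
    (h : rd o c x = rd o c y) : x = y := by
  have := H.rd_conic hc0.le hc1 x y
  rw [h, dist_self] at this
  rcases mul_eq_zero.1 this.symm with h | h
  · exact absurd h hc0.ne'
  · exact dist_eq_zero.1 h

theorem small (M : ℝ) : ∃ e : ℝ, 0 < e ∧ e ≤ 1 ∧ ∀ s, 0 ≤ s → s ≤ M → e * s ≤ 1 := by
  refine ⟨1 / (max M 1), by positivity, ?_, ?_⟩
  · rw [div_le_one (by positivity)]; exact le_max_right _ _
  · intro s hs hM
    rw [one_div, inv_mul_le_one₀ (by positivity)]
    exact hM.trans (le_max_left _ _)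

theorem sm_one (H : Good Y o) (x : Y) : sm o 1 x = x := by
  unfold sm; rw [if_pos le_rfl, H.rd_one]

theorem sm_zero (H : Good Y o) (x : Y) : sm o 0 x = o := by
  unfold sm; rw [if_pos zero_le_one, H.rd_zero]

theorem sm_dist (H : Good Y o) {s t : ℝ} (hs : 0 ≤ s) (ht : 0 ≤ t) (x : Y) :
    dist (sm o s x) (sm o t x) = |s - t| * dist o x := by
  obtain ⟨e, e0, e1, he⟩ := small (max s t)
  have h1 := he s hs (le_max_left _ _)
  have h2 := he t ht (le_max_right _ _)
  have := H.rd_conic e0.le e1 (sm o s x) (sm o t x)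
  rw [H.rd_sm e0.le e1 hs h1, H.rd_sm e0.le e1 ht h2, H.rd_dist (by positivity) h1 (by positivity) h2,
    ← mul_sub, abs_mul, abs_of_pos e0, mul_assoc] at this
  exact (mul_left_cancel₀ e0.ne' this).symm

theorem sm_nrm (H : Good Y o) {t : ℝ} (ht : 0 ≤ t) (x : Y) :
    dist o (sm o t x) = t * dist o x := by
  have := H.sm_dist le_rfl ht x
  rwa [H.sm_zero, zero_sub, abs_neg, abs_of_nonneg ht] at this

theorem sm_conic (H : Good Y o) {t : ℝ} (ht : 0 ≤ t) (x y : Y) :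
    dist (sm o t x) (sm o t y) = t * dist x y := by
  obtain ⟨e, e0, e1, he⟩ := small t
  have h1 := he t ht le_rfl
  have := H.rd_conic e0.le e1 (sm o t x) (sm o t y)
  rw [H.rd_sm e0.le e1 ht h1, H.rd_sm e0.le e1 ht h1, H.rd_conic (by positivity) h1, mul_assoc] at this
  exact (mul_left_cancel₀ e0.ne' this).symm

theorem sm_sm (H : Good Y o) {s t : ℝ} (hs : 0 ≤ s) (ht : 0 ≤ t) (x : Y) :
    sm o s (sm o t x) = sm o (s*t) x := by
  obtain ⟨e, e0, e1, he⟩ := small (max s (s*t))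
  have h1 := he s hs (le_max_left _ _)
  have h2 := he (s*t) (by positivity) (le_max_right _ _)
  refine H.rd_inj e0 e1 ?_
  rw [H.rd_sm e0.le e1 hs h1, H.rd_sm e0.le e1 (by positivity) h2,
    H.rd_sm (by positivity) h1 ht (by rw [mul_assoc]; exact h2), mul_assoc]

theorem sm_sim (H : Good Y o) {c t : ℝ} {h : Y → Y} (hs : Sim o c h)
    (ht : 0 ≤ t) (x : Y) : sm o t (h x) = h (sm o t x) := by
  obtain ⟨e, e0, e1, he⟩ := small t
  have h1 := he t ht le_rfl
  refine H.rd_inj e0 e1 ?_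
  rw [H.rd_sm e0.le e1 ht h1, H.rd_sim hs (by positivity) h1, H.rd_sim hs e0.le e1,
    H.rd_sm e0.le e1 ht h1]

theorem sm_swap (H : Good Y o) {s r : ℝ} (hs : 0 ≤ s) (hr : 0 ≤ r) {x y : Y}
    (hxy : dist o x = dist o y) : dist (sm o s x) (sm o r y) = dist (sm o r x) (sm o s y) := by
  obtain ⟨g, hg, h1, h2⟩ := H.hom2 (c := 1) one_pos (x := x) (y := y) (x' := y) (y' := x)
    (by linarith) (by linarith) (by rw [dist_comm, one_mul])
  have := hg.dst (sm o s x) (sm o r y)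
  rw [← H.sm_sim hg hs, ← H.sm_sim hg hr, h1, h2, one_mul] at this
  rw [← this, dist_comm]

theorem sm_congr (H : Good Y o) {s r : ℝ} (hs : 0 ≤ s) (hr : 0 ≤ r) {x y x' y' : Y}
    (hx : dist o x' = dist o x) (hy : dist o y' = dist o y) (hd : dist x' y' = dist x y) :
    dist (sm o s x) (sm o r y) = dist (sm o s x') (sm o r y') := by
  obtain ⟨g, hg, h1, h2⟩ := H.hom2 (c := 1) one_pos (x := x) (y := y) (x' := x') (y' := y')
    (by linarith) (by linarith) (by linarith)
  have := hg.dst (sm o s x) (sm o r y)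
  rw [← H.sm_sim hg hs, ← H.sm_sim hg hr, h1, h2, one_mul] at this
  exact this.symm

/-- direction -/
noncomputable def dir (o : Y) (a : Y) : Y := sm o (dist o a)⁻¹ a

theorem dir_nrm (H : Good Y o) {a : Y} (ha : a ≠ o) : dist o (dir o a) = 1 := by
  have : 0 < dist o a := dist_pos.2 ha.symm
  rw [dir, H.sm_nrm (by positivity)]
  field_simp

theorem sm_dir (H : Good Y o) {a : Y} (ha : a ≠ o) : sm o (dist o a) (dir o a) = a := by
  have : 0 < dist o a := dist_pos.2 ha.symm
  rw [dir, H.sm_sm (by positivity) (by positivity), mul_inv_cancel₀ this.ne', H.sm_one]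

theorem dir_dist (H : Good Y o) {a b : Y} (ha : a ≠ o) (hb : b ≠ o) :
    dist (dir o a) (dir o b) ≤ 2 * dist a b / dist o a := by
  have ha' : 0 < dist o a := dist_pos.2 ha.symm
  have hb' : 0 < dist o b := dist_pos.2 hb.symm
  have h1 := dist_triangle (dir o a) (sm o (dist o a)⁻¹ b) (dir o b)
  unfold dir at h1 ⊢
  rw [H.sm_conic (by positivity), H.sm_dist (by positivity) (by positivity)] at h1
  have e : |(dist o a)⁻¹ - (dist o b)⁻¹| * dist o b = |dist o b - dist o a| / dist o a := by
    rw [inv_sub_inv ha'.ne' hb'.ne', abs_div, abs_of_pos (mul_pos ha' hb')]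
    field_simp
  rw [e] at h1
  have h2 : |dist o b - dist o a| ≤ dist a b := by
    rw [dist_comm o b, dist_comm o a, dist_comm a b]
    exact abs_dist_sub_le b a o
  refine h1.trans ?_
  rw [← div_eq_inv_mul, ← add_div]
  gcongr
  linarith

end Good

namespace Good
variable {Y : Type u} [MetricSpace Y] {o : Y}

theorem upper (H : Good Y o) {x y : Y} (hx : dist o x = 1) (hy : dist o y = 1) {s r : ℝ}
    (hs : 0 ≤ s) (hr : 0 ≤ r) :
    dist (sm o s x) (sm o r y) ^ 2 ≤ (s-r)^2 + s*r*dist x y^2 := by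
  have h := H.ptol (sm o s x) (sm o r y) (sm o r x) (sm o s y)
  rw [← H.sm_swap hs hr (hx.trans hy.symm), H.sm_dist hs hr, H.sm_dist hr hs, H.sm_conic hs,
    dist_comm (sm o r y), H.sm_conic hr, hx, hy, abs_sub_comm r s] at h
  have := abs_mul_abs_self (s-r)
  nlinarith

theorem lower_arith {D σ ν : ℝ} (hD0 : 0 < D) (hD1 : D ≤ 1) (f : ℝ → ℝ) (hf0 : ∀ t, 0 ≤ t → 0 ≤ f t)
    (hσ0 : 0 ≤ σ) (hν : 0 < ν) (hfD : f 1 = D) (hfν : f ν = σ) (hfσ : ∀ t, 0 ≤ t → σ ≤ f t)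
    (hν1 : 1 - ν ≤ σ)
    (hff : ∀ t1 t2, 0 ≤ t1 → 0 ≤ t2 → σ * |t1 - t2| ≤ f t1 * f t2)
    (hfl : ∀ t, 0 < t → D * (1+t) / 2 ≤ f t)
    (hup : ∀ t, 0 ≤ t → f t ^2 ≤ (1-t)^2 + t * D^2) (t : ℝ) (ht : 0 ≤ t) :
    (1-D)^2 * ((1-t)^2 + t * D^2) ≤ f t ^ 2 := by
  have hσD : σ ≤ D := hfD ▸ hfσ 1 zero_le_one
  have hσl : D * (1-D/2) ≤ σ := by
    have := hfl ν hν
    rw [hfν] at this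
    nlinarith
  set c := 1 - D^2/2 with hc
  have hc0 : 1/2 ≤ c := by nlinarith
  have hc1 : c < 1 := by nlinarith
  set Q := 1 - c^2 with hQ
  have hQ0 : 0 < Q := by nlinarith
  have hQD : Q ≤ D^2 := by rw [hQ, hc]; nlinarith [sq_nonneg (D^2)]
  have hE : ∀ t, (1-t)^2 + t*D^2 = (t-c)^2 + Q := by intro t; rw [hQ, hc]; ring
  have hft := hf0 t ht
  have hl0 : 0 ≤ 1 - D/2 := by linarith
  have hσ2 : (D * (1-D/2))^2 ≤ σ^2 := by gcongr
  have hDD : (1-D)^2 ≤ ((1-D/2)*c)^2 := by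
    have h1 : 1 - D ≤ (1-D/2)*c := by rw [hc]; nlinarith [mul_pos hD0 hD0, mul_pos hD0 (mul_pos hD0 hD0)]
    have h2 : 0 ≤ 1 - D := by linarith
    gcongr
  have hDD' : (1-D)^2 ≤ (1-D/2)^2 := by
    have h2 : 0 ≤ 1 - D := by linarith
    gcongr; linarith
  have hEpos : 0 < (t-c)^2 + Q := by positivity
  have main : ∀ t2, 0 ≤ t2 → (t - c) * (t2 - c) = -Q → (1-D)^2 * ((1-t)^2 + t * D^2) ≤ f t ^ 2 := by
    intro t2 ht2 hrel
    have htc : t - c ≠ 0 := by intro h; rw [h] at hrel; linarith [hrel]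
    have htc2 : 0 < (t-c)^2 := by positivity
    have h1 := hff t t2 ht ht2
    have h2 := hup t2 ht2
    rw [hE t2] at h2
    rw [hE t]
    have h3 : (σ * |t-t2|)^2 ≤ (f t * f t2)^2 := by gcongr
    rw [mul_pow, mul_pow, sq_abs] at h3
    have h4 : σ^2 * (t-t2)^2 ≤ f t^2 * ((t2-c)^2 + Q) := by
      refine h3.trans ?_
      gcongr
    have e1 : (t-t2)^2 * (t-c)^2 = ((t-c)^2 + Q)^2 := by
      have : (t-t2)*(t-c) = (t-c)^2 + Q := by linear_combination -hrel
      rw [← mul_pow, this]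
    have e2 : ((t2-c)^2+Q) * (t-c)^2 = Q * ((t-c)^2 + Q) := by
      have : ((t-c)*(t2-c))^2 = Q^2 := by rw [hrel]; ring
      linear_combination this
    have h5 : σ^2 * ((t-c)^2+Q)^2 ≤ f t^2 * (Q * ((t-c)^2 + Q)) := by
      rw [← e1, ← e2]
      have := mul_le_mul_of_nonneg_right h4 htc2.le
      linarith
    have h6 : σ^2 * ((t-c)^2+Q) ≤ f t^2 * Q := by
      refine le_of_mul_le_mul_right ?_ hEpos
      linarith
    have h7 : f t^2 * Q ≤ f t^2 * D^2 := by gcongr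
    have h8 : D^2 * ((1-D)^2 * ((t-c)^2 + Q)) ≤ D^2 * f t^2 := by
      calc D^2 * ((1-D)^2 * ((t-c)^2 + Q)) ≤ D^2 * ((1-D/2)^2 * ((t-c)^2 + Q)) := by gcongr
        _ = (D * (1-D/2))^2 * ((t-c)^2 + Q) := by ring
        _ ≤ σ^2 * ((t-c)^2 + Q) := by gcongr
        _ ≤ D^2 * f t^2 := by linarith
    exact le_of_mul_le_mul_left h8 (by positivity)
  rcases lt_or_ge t c with htc | htc
  · refine main (c + Q/(c-t)) ?_ ?_
    · have : 0 < c - t := by linarith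
      positivity
    · have : c - t ≠ 0 := by linarith
      field_simp
      ring
  rcases lt_or_ge (c*t) 1 with hct | hct
  · rw [hE t]
    have h1 : c^2 * ((t-c)^2+Q) ≤ Q := by
      have a1 : 0 ≤ c*t - c^2 := by nlinarith
      have a2 : c*t - c^2 ≤ Q := by rw [hQ]; linarith
      have a3 : (c*t-c^2)^2 ≤ Q^2 := by gcongr
      have a4 : c^2 + Q = 1 := by rw [hQ]; ring
      nlinarith
    calc (1-D)^2 * ((t-c)^2 + Q) ≤ ((1-D/2)*c)^2 * ((t-c)^2 + Q) := by gcongr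
      _ = (1-D/2)^2 * (c^2 * ((t-c)^2 + Q)) := by ring
      _ ≤ (1-D/2)^2 * D^2 := by gcongr; linarith
      _ = (D * (1-D/2))^2 := by ring
      _ ≤ σ^2 := hσ2
      _ ≤ f t ^2 := by gcongr; exact hfσ t ht
  · have htc' : c < t := by
      by_contra hle
      push Not at hle
      have hc00 : 0 < c := by linarith
      have a1 : c * t ≤ c * c := mul_le_mul_of_nonneg_left hle hc00.le
      have a2 : c * c < c * 1 := mul_lt_mul_of_pos_left hc1 hc00
      linarith
    refine main (c - Q/(t-c)) ?_ ?_
    · have : 0 < t - c := by linarith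
      rw [sub_nonneg, div_le_iff₀ this, hQ]
      linarith
    · have : t - c ≠ 0 := by linarith
      field_simp
      ring

theorem lower_special (H : Good Y o) {x x' w : Y} (hx : dist o x = 1) 
    (hw : dist o w = 1) {σ ν : ℝ} (hσ : dist x x' = 2*σ) (hν : 0 < ν) (hxw : dist x (sm o ν w) = σ)
    (hf : ∀ t, 0 ≤ t → dist x' (sm o t w) = dist x (sm o t w)) (hD0 : 0 < dist x w)
    (hD1 : dist x w ≤ 1) (t : ℝ) (ht : 0 ≤ t) :
    (1-dist x w)^2 * ((1-t)^2 + t * dist x w^2) ≤ dist x (sm o t w) ^ 2 := by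
  refine lower_arith hD0 hD1 (fun t => dist x (sm o t w)) (fun _ _ => dist_nonneg) ?_ hν ?_ hxw
    ?_ ?_ ?_ ?_ ?_ t ht
  · linarith [dist_nonneg (x := x) (y := x')]
  · simp only [H.sm_one]
  · intro t ht
    have h1 := dist_triangle_right x x' (sm o t w)
    rw [hf t ht, hσ] at h1
    linarith
  · have h1 := dist_triangle_right o x (sm o ν w)
    rw [H.sm_nrm hν.le, hw, hxw, hx] at h1
    linarith
  · intro t1 t2 h1 h2
    have := H.ptol x x' (sm o t1 w) (sm o t2 w)
    rw [hf t1 h1, hf t2 h2, H.sm_dist h1 h2, hw, hσ] at this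
    linarith
  · intro t ht
    rcases eq_or_ne t 1 with rfl | hne
    · rw [H.sm_one]; linarith
    have hti : 0 < t⁻¹ := by positivity
    have h1 := H.ptol x w (sm o t w) (sm o t⁻¹ w)
    have e1 : dist w (sm o t⁻¹ w) = |1-t| / t := by
      nth_rewrite 1 [← H.sm_one w]
      rw [H.sm_dist zero_le_one hti.le, hw, mul_one, ← abs_of_pos ht, ← abs_div, abs_of_pos ht,
        abs_sub_comm]
      congr 1; field_simp
    have e2 : dist w (sm o t w) = |1-t| := by
      nth_rewrite 1 [← H.sm_one w]
      rw [H.sm_dist zero_le_one ht.le, hw, mul_one]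
    have e3 : dist (sm o t w) (sm o t⁻¹ w) = |1-t| / t * (1+t) := by
      rw [H.sm_dist ht.le hti.le, hw, mul_one]
      have : t - t⁻¹ = -((1-t)/t*(1+t)) := by field_simp; ring
      rw [this, abs_neg, abs_mul, abs_div, abs_of_pos ht, abs_of_pos (show 0 < 1+t by linarith)]
    have e4 : dist x (sm o t⁻¹ w) = dist x (sm o t w) / t := by
      have := H.sm_swap zero_le_one hti.le (hx.trans hw.symm)
      rw [H.sm_one, H.sm_one] at this
      rw [this]
      have h5 := H.sm_conic hti.le x (sm o t w)
      rw [H.sm_sm hti.le ht.le, inv_mul_cancel₀ ht.ne', H.sm_one] at h5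
      rw [h5, div_eq_inv_mul]
    rw [e1, e2, e3, e4] at h1
    have hpos : 0 < |1-t| / t := by
      have : 0 < |1-t| := abs_pos.2 (sub_ne_zero.2 hne.symm)
      positivity
    have h2 : (|1-t|/t) * (dist x w * (1+t)) ≤ (|1-t|/t) * (2 * dist x (sm o t w)) := by
      have : dist x (sm o t w) / t * |1-t| = |1-t|/t * dist x (sm o t w) := by ring
      linarith
    have := le_of_mul_le_mul_left h2 hpos
    linarith
  · intro t ht
    have := H.upper hx hw zero_le_one ht
    rw [H.sm_one] at this
    simpa using this

theorem dir_sim (H : Good Y o) {g : Y → Y} (hg : Sim o 1 g) (a : Y) :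
    dir o (g a) = g (dir o a) := by
  unfold dir
  rw [hg.nrm, one_mul, H.sm_sim hg (by positivity)]

theorem lower (H : Good Y o) : ∃ D1 : ℝ, 0 < D1 ∧ D1 ≤ 1 ∧ ∀ x w : Y, dist o x = 1 → dist o w = 1 →
    dist x w ≤ D1 → ∀ s r : ℝ, 0 ≤ s → 0 ≤ r →
    (1-dist x w)^2 * ((s-r)^2 + s*r*dist x w^2) ≤ dist (sm o s x) (sm o r w)^2 := by
  by_cases hcase : ∀ y z : Y, dist o y = 1 → dist o z = 1 → y ≠ z → 2 ≤ dist y z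
  · refine ⟨1, one_pos, le_rfl, fun x w hx hw hd s r hs hr => ?_⟩
    have : x = w := by
      by_contra hne
      linarith [hcase x w hx hw hne]
    subst this
    rw [H.sm_dist hs hr, hx]
    simp
  push Not at hcase
  obtain ⟨y, z, hy, hz, hyz, hlt⟩ := hcase
  obtain ⟨m, hm1, hm2⟩ := H.mid y z
  set L := dist y z / 2 with hL
  have hL0 : 0 < L := by have := dist_pos.2 hyz; positivity
  have hL1 : L < 1 := by linarith
  have hmo : m ≠ o := by
    rintro rfl
    linarith
  obtain ⟨g, hg, gy, gz, gm⟩ := H.hom3 (c := 1) one_pos (x := y) (y := z) (z := m) (x' := z)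
    (y' := y) (z' := m) (by linarith) (by linarith) (by linarith) (by rw [dist_comm]; ring)
    (by rw [dist_comm, hm2, dist_comm y, hm1]; ring) (by rw [dist_comm, hm1, dist_comm z, hm2]; ring)
  obtain ⟨γ, hγ, γ0, γ1⟩ := geodesic_of_mid H.proper H.mid m y
  rw [hm1] at hγ γ1
  have γm : ∀ τ ∈ Set.Icc 0 L, dist m (γ τ) = τ := by
    intro τ hτ
    have := hγ 0 ⟨le_rfl, hL0.le⟩ τ hτ
    rwa [γ0, zero_sub, abs_neg, abs_of_nonneg hτ.1] at this
  have γy : ∀ τ ∈ Set.Icc 0 L, dist (γ τ) y = L - τ := by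
    intro τ hτ
    have := hγ τ hτ L ⟨hL0.le, le_rfl⟩
    rw [γ1, abs_of_nonpos (by linarith [hτ.2])] at this
    linarith
  have γn : ∀ τ ∈ Set.Icc 0 L, 1 - L ≤ dist o (γ τ) := by
    intro τ hτ
    have h1 := dist_triangle o (γ τ) y
    rw [γy τ hτ, hy] at h1
    linarith [hτ.1]
  have γo : ∀ τ ∈ Set.Icc 0 L, γ τ ≠ o := by
    intro τ hτ h
    have := γn τ hτ
    rw [h, dist_self] at this
    linarith
  set w := dir o m with hw
  have hw1 : dist o w = 1 := H.dir_nrm hmo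
  have hcont : ContinuousOn (fun τ => dist (dir o (γ τ)) w) (Set.Icc 0 L) := by
    have : LipschitzOnWith (Real.toNNReal (2/(1-L))) (fun t => dir o (γ t)) (Set.Icc 0 L) := by
      refine LipschitzOnWith.of_dist_le_mul fun s hs t ht => ?_
      have h1 := H.dir_dist (γo s hs) (γo t ht)
      rw [hγ s hs t ht] at h1
      rw [Real.dist_eq, Real.coe_toNNReal _ (div_nonneg zero_le_two (by linarith))]
      refine h1.trans ?_
      rw [div_mul_eq_mul_div]
      have := γn s hs
      have : 0 < 1 - L := by linarith
      gcongr
    exact continuous_dist.comp_continuousOn (this.continuousOn.prodMk continuousOn_const)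
  have hD0 : dist (dir o (γ 0)) w = 0 := by rw [γ0, dist_self]
  have hydir : dir o y = y := by unfold dir; rw [hy, inv_one, H.sm_one]
  have hDL : 0 < dist (dir o (γ L)) w := by
    rw [dist_pos, γ1, hydir]
    intro h
    have h2 : g y = g w := by rw [h]
    rw [gy, hw, ← H.dir_sim hg, gm, ← hw, ← h] at h2
    exact hyz h2.symm
  refine ⟨min 1 (dist (dir o (γ L)) w), lt_min one_pos hDL, min_le_left _ _, ?_⟩
  intro X W hX hW hXW s r hs hr
  rcases eq_or_ne X W with rfl | hne
  · rw [H.sm_dist hs hr, hX]; simp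
  have hXW0 := dist_pos.2 hne
  have hXW1 : dist X W ≤ 1 := hXW.trans (min_le_left _ _)
  have hXW2 : dist X W ≤ dist (dir o (γ L)) w := hXW.trans (min_le_right _ _)
  obtain ⟨τ, hτ, hτD⟩ := intermediate_value_Icc hL0.le hcont
    (show dist X W ∈ Set.Icc _ _ from ⟨by rw [hD0]; exact hXW0.le, hXW2⟩)
  simp only at hτD
  set ρ := dist o (γ τ) with hρ
  have hρ0 : 0 < ρ := dist_pos.2 (γo τ hτ).symm
  set x := dir o (γ τ) with hx
  have hx1 : dist o x = 1 := H.dir_nrm (γo τ hτ)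
  have hgw : g w = w := by rw [hw, ← H.dir_sim hg, gm]
  have hgd : dist (γ τ) (g (γ τ)) = 2 * τ := by
    have h1 := dist_triangle_left (γ τ) (g (γ τ)) m
    have h2 := dist_triangle4 y (γ τ) (g (γ τ)) z
    have h3 : dist m (g (γ τ)) = τ := by
      nth_rewrite 1 [← gm]
      rw [hg.dst, γm τ hτ, one_mul]
    have h4 : dist (g (γ τ)) z = L - τ := by
      rw [← gy, hg.dst, γy τ hτ, one_mul]
    rw [γm τ hτ, h3] at h1
    rw [dist_comm y (γ τ), γy τ hτ, h4] at h2
    linarith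
  have main := H.lower_special (x := x) (x' := g x) (w := w) (σ := τ/ρ) (ν := dist o m/ρ) hx1 hw1
    (by
      rw [hx, ← H.dir_sim hg]
      unfold dir
      rw [hg.nrm, one_mul, H.sm_conic (by positivity), hgd, ← hρ]
      field_simp)
    (div_pos (dist_pos.2 hmo.symm) hρ0)
    (by
      have : sm o (dist o m / ρ) w = sm o ρ⁻¹ m := by
        conv_rhs => rw [← H.sm_dir hmo]
        rw [H.sm_sm (by positivity) dist_nonneg, ← hw]
        congr 1; field_simp
      rw [this, hx]
      unfold dir
      rw [H.sm_conic (by positivity), dist_comm (γ τ) m, γm τ hτ, ← hρ]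
      field_simp)
    (by
      intro t ht
      have : sm o t w = g (sm o t w) := by rw [← H.sm_sim hg ht, hgw]
      conv_lhs => rw [this]
      rw [hg.dst, one_mul])
    (by rw [hτD]; exact hXW0) (by rw [hτD]; exact hXW1)
  rw [hτD] at main
  rw [H.sm_congr hs hr (x := X) (y := W) (x' := x) (y' := w) (by rw [hx1, hX]) (by rw [hw1, hW]) hτD]
  rcases eq_or_lt_of_le hs with rfl | hs'
  · rw [H.sm_zero, H.sm_nrm hr, hw1]
    have : (1 - dist X W)^2 ≤ 1 := by nlinarith
    nlinarith [sq_nonneg r]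
  · have h1 := main (r/s) (by positivity)
    have h2 := H.sm_conic hs x (sm o (r/s) w)
    rw [H.sm_sm hs (by positivity), mul_div_cancel₀ _ hs'.ne'] at h2
    rw [h2, mul_pow]
    have h3 : (s-r)^2 + s*r*dist X W^2 = s^2 * ((1-r/s)^2 + r/s*dist X W^2) := by
      field_simp
    rw [h3]
    have := mul_le_mul_of_nonneg_left h1 (sq_nonneg s)
    linarith

end Good

/-- planar distance -/
noncomputable def EE (s r α : ℝ) : ℝ := ‖(s:ℂ) - r * Complex.exp (α * Complex.I)‖

theorem EE_sq (s r α : ℝ) : EE s r α ^ 2 = s^2 + r^2 - 2*s*r*Real.cos α := by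
  unfold EE
  rw [Complex.sq_norm, Complex.exp_mul_I, Complex.normSq_apply]
  simp only [Complex.sub_re, Complex.sub_im, Complex.mul_re, Complex.mul_im, Complex.ofReal_re,
    Complex.ofReal_im, Complex.add_re, Complex.add_im, Complex.I_re, Complex.I_im,
    ← Complex.ofReal_cos, ← Complex.ofReal_sin]
  have := Real.sin_sq_add_cos_sq α
  linear_combination r^2 * this

theorem EE_nonneg (s r α : ℝ) : 0 ≤ EE s r α := norm_nonneg _

theorem EE_tri (s q r α β : ℝ) : EE s r (α+β) ≤ EE s q α + EE q r β := by
  have h : EE q r β = ‖(q:ℂ) * Complex.exp (α * Complex.I) - r * Complex.exp ((α+β : ℝ) * Complex.I)‖ := by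
    have : (q:ℂ) * Complex.exp (α * Complex.I) - r * Complex.exp ((α+β : ℝ) * Complex.I)
      = Complex.exp (α * Complex.I) * (q - r * Complex.exp (β * Complex.I)) := by
      push_cast
      rw [add_mul, Complex.exp_add]; ring
    rw [this, norm_mul, Complex.norm_exp_ofReal_mul_I, one_mul]
    rfl
  rw [h]
  unfold EE
  exact norm_sub_le_norm_sub_add_norm_sub _ _ _

theorem EE_mono {s r α β : ℝ} (hs : 0 ≤ s) (hr : 0 ≤ r) (hα : 0 ≤ α) (hβ : β ≤ Real.pi)
    (h : α ≤ β) : EE s r α ≤ EE s r β := by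
  have h1 := Real.cos_le_cos_of_nonneg_of_le_pi hα hβ h
  refine le_of_sq_le_sq ?_ (EE_nonneg _ _ _)
  rw [EE_sq, EE_sq]
  have := mul_nonneg hs hr
  nlinarith

theorem EE_pi {s r : ℝ} (hs : 0 ≤ s) (hr : 0 ≤ r) : EE s r Real.pi = s + r := by
  have h := EE_sq s r Real.pi
  rw [Real.cos_pi] at h
  have h2 : EE s r Real.pi ^2 = (s+r)^2 := by rw [h]; ring
  exact (sq_eq_sq₀ (EE_nonneg _ _ _) (by positivity)).1 h2

theorem EE_le_add {s r α : ℝ} (hs : 0 ≤ s) (hr : 0 ≤ r) : EE s r α ≤ s + r := by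
  refine le_of_sq_le_sq ?_ (by positivity)
  rw [EE_sq]
  have := mul_nonneg hs hr
  nlinarith [Real.neg_one_le_cos α]

theorem EE_tri' {s q r α β θ : ℝ} (hs : 0 ≤ s) (hq : 0 ≤ q) (hr : 0 ≤ r) (hα0 : 0 ≤ α)
    (hα : α ≤ Real.pi) (hβ : β ≤ Real.pi) (hθ0 : 0 ≤ θ) (hθ : θ ≤ α + β) :
    EE s r θ ≤ EE s q α + EE q r β := by
  rcases le_or_gt (α+β) Real.pi with h | h
  · exact (EE_mono hs hr hθ0 h hθ).trans (EE_tri _ _ _ _ _)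
  · have h1 := EE_tri s q r α (Real.pi - α)
    rw [add_sub_cancel, EE_pi hs hr] at h1
    have h2 := EE_mono hq hr (α := Real.pi - α) (β := β) (by linarith) hβ (by linarith)
    have h3 := EE_le_add (α := θ) hs hr
    linarith

theorem EE_split {s r α β : ℝ} (hs : 0 < s) (hr : 0 ≤ r) (hα0 : 0 < α) (hβ0 : 0 ≤ β)
    (h : α + β < Real.pi) : ∃ q, 0 ≤ q ∧ EE s q α + EE q r β = EE s r (α+β) := by
  have sa : 0 < Real.sin α := Real.sin_pos_of_pos_of_lt_pi hα0 (by linarith)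
  have sb : 0 ≤ Real.sin β := Real.sin_nonneg_of_nonneg_of_le_pi hβ0 (by linarith)
  have sab : 0 < Real.sin (α+β) := Real.sin_pos_of_pos_of_lt_pi (by linarith) h
  set den := s * Real.sin α + r * Real.sin β with hden
  have hd : 0 < den := by positivity
  set q := s*r*Real.sin (α+β)/den with hq
  set l := r * Real.sin β / den with hl
  set l' := s * Real.sin α / den with hl'
  have hll : l + l' = 1 := by rw [hl, hl']; field_simp; rw [hden]; ring
  have hsb : Real.sin β = Real.sin (α+β) * Real.cos α - Real.cos (α+β) * Real.sin α := by
    rw [← Real.sin_sub]; congr 1; ring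
  have hcb : Real.cos β = Real.cos (α+β) * Real.cos α + Real.sin (α+β) * Real.sin α := by
    rw [← Real.cos_sub]; congr 1; ring
  have e1 : q * Real.sin α = l' * (r * Real.sin (α+β)) := by rw [hq, hl']; field_simp
  have e2 : q * Real.cos α = l * s + l' * (r * Real.cos (α+β)) := by
    rw [hq, hl, hl', hsb]; field_simp; ring
  have p1 := Real.sin_sq_add_cos_sq α
  have p2 := Real.sin_sq_add_cos_sq (α+β)
  have E1 : EE s q α = l' * EE s r (α+β) := by
    refine (sq_eq_sq₀ (EE_nonneg _ _ _) (mul_nonneg (by positivity) (EE_nonneg _ _ _))).1 ?_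
    rw [mul_pow, EE_sq, EE_sq]
    have a : s^2 + q^2 - 2*s*q*Real.cos α = (s - q * Real.cos α)^2 + (q * Real.sin α)^2 := by
      linear_combination -q^2 * p1
    have b : l = 1 - l' := by linarith
    rw [a, e1, e2, b]
    linear_combination l'^2*r^2*p2
  have E2 : EE q r β = l * EE s r (α+β) := by
    refine (sq_eq_sq₀ (EE_nonneg _ _ _) (mul_nonneg (by positivity) (EE_nonneg _ _ _))).1 ?_
    rw [mul_pow, EE_sq, EE_sq]
    have a : q^2 + r^2 - 2*q*r*Real.cos β = (q * Real.cos α - r * Real.cos (α+β))^2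
        + (q * Real.sin α - r * Real.sin (α+β))^2 := by
      rw [hcb]
      linear_combination -q^2 * p1 - r^2 * p2
    have b : l' = 1 - l := by linarith
    rw [a, e1, e2, b]
    linear_combination l^2*r^2*p2
  refine ⟨q, by positivity, ?_⟩
  rw [E1, E2, ← add_mul, add_comm l', hll, one_mul]

namespace Good
variable {Y : Type u} [MetricSpace Y] {o : Y}

/-- angle bound -/
def UU (o x y : Y) (α : ℝ) : Prop :=
  ∀ s r : ℝ, 0 ≤ s → 0 ≤ r → dist (sm o s x) (sm o r y)^2 ≤ s^2 + r^2 - 2*s*r*Real.cos α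

theorem UU_le {x y : Y} {α : ℝ} (h : UU o x y α) {s r : ℝ} (hs : 0 ≤ s) (hr : 0 ≤ r) :
    dist (sm o s x) (sm o r y) ≤ EE s r α := by
  refine le_of_sq_le_sq ?_ (EE_nonneg _ _ _)
  rw [EE_sq]; exact h s r hs hr

/-- the angle -/
noncomputable def Th (o x y : Y) : ℝ := sInf {α | α ∈ Set.Icc 0 Real.pi ∧ UU o x y α}

theorem UU_pi (H : Good Y o) {x y : Y} (hx : dist o x = 1) (hy : dist o y = 1) :
    UU o x y Real.pi := by
  intro s r hs hr
  have h := dist_triangle_left (sm o s x) (sm o r y) o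
  rw [H.sm_nrm hs, H.sm_nrm hr, hx, hy, mul_one, mul_one] at h
  rw [Real.cos_pi]
  nlinarith [dist_nonneg (x := sm o s x) (y := sm o r y)]

theorem Th_mem (H : Good Y o) {x y : Y} (hx : dist o x = 1) (hy : dist o y = 1) :
    Th o x y ∈ {α | α ∈ Set.Icc 0 Real.pi ∧ UU o x y α} := by
  refine IsCompact.sInf_mem ?_ ⟨Real.pi, ⟨Real.pi_pos.le, le_rfl⟩, H.UU_pi hx hy⟩
  refine (isCompact_Icc (a := 0) (b := Real.pi)).of_isClosed_subset ?_ (fun α h => h.1)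
  refine isClosed_Icc.inter ?_
  have : {α | UU o x y α} = ⋂ s : ℝ, ⋂ r : ℝ, ⋂ _ : 0 ≤ s, ⋂ _ : 0 ≤ r,
      {α | dist (sm o s x) (sm o r y)^2 ≤ s^2 + r^2 - 2*s*r*Real.cos α} := by
    ext α; simp [UU]
  change IsClosed {α | UU o x y α}
  rw [this]
  refine isClosed_iInter fun s => isClosed_iInter fun r => isClosed_iInter fun _ =>
    isClosed_iInter fun _ => isClosed_le (by fun_prop) ?_
  have := Real.continuous_cos
  fun_prop

theorem Th_le {x y : Y} {α : ℝ} (h0 : 0 ≤ α) (h1 : α ≤ Real.pi) (h : UU o x y α) :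
    Th o x y ≤ α :=
  csInf_le ⟨0, fun _ h => h.1.1⟩ ⟨⟨h0, h1⟩, h⟩

theorem UU_add (H : Good Y o) {x y z : Y} (hx : dist o x = 1)
    (hz : dist o z = 1) {α β : ℝ} (hα0 : 0 ≤ α) (hβ0 : 0 ≤ β) (h1 : UU o x y α) (h2 : UU o y z β)
    (h : α + β < Real.pi) : UU o x z (α+β) := by
  rcases eq_or_lt_of_le hα0 with rfl | hα
  · have := h1 1 1 zero_le_one zero_le_one
    rw [H.sm_one, H.sm_one, Real.cos_zero] at this
    have hd : dist x y = 0 := by nlinarith [dist_nonneg (x := x) (y := y)]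
    rw [dist_eq_zero.1 hd, zero_add]
    exact h2
  intro s r hs hr
  rw [← EE_sq]
  rcases eq_or_lt_of_le hs with rfl | hs'
  · rw [H.sm_zero, H.sm_nrm hr, hz, EE_sq]
    simp
  obtain ⟨q, hq, hE⟩ := EE_split hs' hr hα hβ0 h
  have t := dist_triangle (sm o s x) (sm o q y) (sm o r z)
  have t1 := UU_le h1 hs hq
  have t2 := UU_le h2 hq hr
  have : dist (sm o s x) (sm o r z) ≤ EE s r (α+β) := by linarith
  gcongr

theorem Th_tri (H : Good Y o) {x y z : Y} (hx : dist o x = 1) (hy : dist o y = 1)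
    (hz : dist o z = 1) : Th o x z ≤ Th o x y + Th o y z := by
  have a := H.Th_mem hx hy
  have b := H.Th_mem hy hz
  rcases lt_or_ge (Th o x y + Th o y z) Real.pi with h | h
  · exact Th_le (add_nonneg a.1.1 b.1.1) h.le (H.UU_add hx hz a.1.1 b.1.1 a.2 b.2 h)
  · exact (H.Th_mem hx hz).1.2.trans h

/-- cone distance -/
noncomputable def ee (o a b : Y) : ℝ := EE (dist o a) (dist o b) (Th o (dir o a) (dir o b))

theorem ee_tri (H : Good Y o) {a b c : Y} (ha : a ≠ o) (hb : b ≠ o) (hc : c ≠ o) :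
    ee o a c ≤ ee o a b + ee o b c := by
  have h1 := H.Th_mem (H.dir_nrm ha) (H.dir_nrm hb)
  have h2 := H.Th_mem (H.dir_nrm hb) (H.dir_nrm hc)
  have h3 := H.Th_mem (H.dir_nrm ha) (H.dir_nrm hc)
  exact EE_tri' dist_nonneg dist_nonneg dist_nonneg h1.1.1 h1.1.2 h2.1.2 h3.1.1
    (H.Th_tri (H.dir_nrm ha) (H.dir_nrm hb) (H.dir_nrm hc))

theorem le_ee (H : Good Y o) {a b : Y} (ha : a ≠ o) (hb : b ≠ o) : dist a b ≤ ee o a b := by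
  have h1 := H.Th_mem (H.dir_nrm ha) (H.dir_nrm hb)
  have h2 := UU_le h1.2 (dist_nonneg (x := o) (y := a)) (dist_nonneg (x := o) (y := b))
  rwa [H.sm_dir ha, H.sm_dir hb] at h2

theorem ee_self (H : Good Y o) {a : Y} (ha : a ≠ o) : ee o a a = 0 := by
  have h1 := H.Th_mem (H.dir_nrm ha) (H.dir_nrm ha)
  have h2 : Th o (dir o a) (dir o a) ≤ 0 := by
    refine Th_le le_rfl Real.pi_pos.le ?_
    intro s r hs hr
    rw [H.sm_dist hs hr, H.dir_nrm ha, mul_one, sq_abs, Real.cos_zero]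
    linarith [sq_nonneg (s-r)]
  have h3 : Th o (dir o a) (dir o a) = 0 := le_antisymm h2 h1.1.1
  unfold ee
  rw [h3]
  have := EE_sq (dist o a) (dist o a) 0
  rw [Real.cos_zero] at this
  refine pow_eq_zero_iff (two_ne_zero) |>.1 (this.trans (by ring))

theorem ee_local (H : Good Y o) : ∃ D1 : ℝ, 0 < D1 ∧ D1 ≤ 1 ∧ ∀ a b : Y, a ≠ o → b ≠ o →
    dist (dir o a) (dir o b) ≤ D1 → (1 - dist (dir o a) (dir o b)) * ee o a b ≤ dist a b := by
  obtain ⟨D1, h0, h1, hl⟩ := H.lower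
  refine ⟨D1, h0, h1, fun a b ha hb hD => ?_⟩
  have hx := H.dir_nrm ha
  have hy := H.dir_nrm hb
  have h2 := hl _ _ hx hy hD (dist o a) (dist o b) dist_nonneg dist_nonneg
  rw [H.sm_dir ha, H.sm_dir hb] at h2
  set D := dist (dir o a) (dir o b) with hDD
  have hD0 : 0 ≤ D := dist_nonneg
  have hc : Real.cos (Real.arccos (1 - D^2/2)) = 1 - D^2/2 :=
    Real.cos_arccos (by nlinarith) (by nlinarith)
  have h3 : Th o (dir o a) (dir o b) ≤ Real.arccos (1 - D^2/2) := by
    refine Th_le (Real.arccos_nonneg _) (Real.arccos_le_pi _) ?_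
    intro s r hs hr
    rw [hc]
    refine (H.upper hx hy hs hr).trans (le_of_eq ?_)
    rw [← hDD]; ring
  have h4 := EE_mono (dist_nonneg (x := o) (y := a)) (dist_nonneg (x := o) (y := b))
    (H.Th_mem hx hy).1.1 (Real.arccos_le_pi _) h3
  refine le_of_sq_le_sq ?_ dist_nonneg
  refine le_trans ?_ h2
  rw [mul_pow]
  gcongr
  unfold ee
  calc _ ≤ EE (dist o a) (dist o b) (Real.arccos (1-D^2/2)) ^ 2 := by
        have := EE_nonneg (dist o a) (dist o b) (Th o (dir o a) (dir o b))
        gcongr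
    _ = _ := by rw [EE_sq, hc]; ring

theorem ee_eq (H : Good Y o) {a b : Y} (ha : a ≠ o) (hb : b ≠ o) : dist a b = ee o a b := by
  refine le_antisymm (H.le_ee ha hb) ?_
  obtain ⟨f, hf, f0, f1⟩ := geodesic_of_mid H.proper H.mid a b
  set L := dist a b with hL
  have hL0 : 0 ≤ L := dist_nonneg
  by_cases hit : ∃ τ ∈ Set.Icc 0 L, f τ = o
  · obtain ⟨τ, hτ, hfo⟩ := hit
    have h1 := hf 0 ⟨le_rfl, hL0⟩ τ hτ
    have h2 := hf τ hτ L ⟨hL0, le_rfl⟩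
    rw [f0, hfo, zero_sub, abs_neg, abs_of_nonneg hτ.1] at h1
    rw [f1, hfo, abs_of_nonpos (by linarith [hτ.2])] at h2
    have h3 : ee o a b ≤ dist o a + dist o b := EE_le_add dist_nonneg dist_nonneg
    rw [dist_comm o a] at h3
    linarith
  push Not at hit
  have hcont : ContinuousOn f (Set.Icc 0 L) := by
    have : LipschitzOnWith 1 f (Set.Icc 0 L) := by
      refine LipschitzOnWith.of_dist_le_mul fun s hs t ht => ?_
      rw [hf s hs t ht, Real.dist_eq]; simp
    exact this.continuousOn
  obtain ⟨τ0, hτ0, hmin⟩ := (isCompact_Icc (a := (0:ℝ)) (b := L)).exists_isMinOn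
    ⟨0, le_rfl, hL0⟩ (continuous_dist.comp_continuousOn ((continuousOn_const (c := o)).prodMk hcont))
  set μ := dist o (f τ0) with hμ
  have hμ0 : 0 < μ := dist_pos.2 (hit τ0 hτ0).symm
  have hμm : ∀ τ ∈ Set.Icc 0 L, μ ≤ dist o (f τ) := fun τ hτ => hmin hτ
  obtain ⟨D1, hD0, hD1, hloc⟩ := H.ee_local
  have key : ∀ η, 0 < η → η ≤ D1 → (1-η) * ee o a b ≤ L := by
    intro η hη hηD
    obtain ⟨n, hn⟩ := exists_nat_gt (2 * L / (μ * η))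
    have hn0 : (0:ℝ) < n := lt_of_le_of_lt (by positivity) hn
    set e := L / n with he
    have he0 : 0 ≤ e := by positivity
    have hne : n * e = L := by rw [he]; field_simp
    have hsm : 2 * e / μ ≤ η := by
      rw [div_lt_iff₀ (by positivity)] at hn
      rw [div_le_iff₀ hμ0, he, mul_div_assoc', div_le_iff₀ hn0]
      linarith
    have hmem : ∀ k : ℕ, k ≤ n → (k:ℝ) * e ∈ Set.Icc 0 L := by
      intro k hk
      refine ⟨by positivity, ?_⟩
      rw [← hne]
      gcongr
    have ind : ∀ k : ℕ, k ≤ n → (1-η) * ee o a (f (k*e)) ≤ k * e := by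
      intro k
      induction k with
      | zero => intro _; simp [f0, H.ee_self ha]
      | succ k ih =>
        intro hk
        have m1 := hmem k (by omega)
        have m2 := hmem (k+1) hk
        have i1 := ih (by omega)
        have d1 := hf _ m1 _ m2
        have e1 : |(k:ℝ) * e - ((k+1:ℕ):ℝ) * e| = e := by
          rw [← sub_mul]; push_cast
          rw [show (k:ℝ) - (k+1) = -1 by ring, neg_one_mul, abs_neg, abs_of_nonneg he0]
        rw [e1] at d1
        have d2 := H.dir_dist (hit _ m1) (hit _ m2)
        rw [d1] at d2
        have d3 : 2 * e / dist o (f (k*e)) ≤ 2 * e / μ := by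
          have := hμm _ m1
          gcongr
        have d4 := hloc _ _ (hit _ m1) (hit _ m2) (by linarith)
        rw [d1] at d4
        have t := H.ee_tri ha (hit _ m1) (hit _ m2)
        have en : 0 ≤ ee o (f (k*e)) (f ((k+1:ℕ)*e)) := EE_nonneg _ _ _
        have d5 : (1-η) * ee o (f (k*e)) (f ((k+1:ℕ)*e)) ≤ e := by
          refine le_trans ?_ d4
          gcongr
          linarith
        have d6 := mul_le_mul_of_nonneg_left t (show 0 ≤ 1 - η by linarith)
        push_cast at *
        linarith
    have := ind n le_rfl
    rwa [hne, f1] at this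
  by_contra hlt
  push Not at hlt
  have hpos : 0 < ee o a b := by linarith
  have h1 := key (min D1 ((ee o a b - L)/(2*ee o a b))) (lt_min hD0 (by
    have : 0 < ee o a b - L := by linarith
    positivity)) (min_le_left _ _)
  have h2 := min_le_right D1 ((ee o a b - L)/(2*ee o a b))
  have h3 : min D1 ((ee o a b - L)/(2*ee o a b)) * ee o a b ≤ (ee o a b - L)/2 := by
    refine (mul_le_mul_of_nonneg_right h2 hpos.le).trans (le_of_eq ?_)
    field_simp
  linarith

theorem cos_law (H : Good Y o) {t : ℝ} (ht : 0 ≤ t) (a b : Y) :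
    dist (sm o t a) b ^ 2 = t^2 * dist o a^2 + dist o b^2
      - t * (dist o a^2 + dist o b^2 - dist a b^2) := by
  rcases eq_or_lt_of_le ht with rfl | ht'
  · rw [H.sm_zero]; ring
  rcases eq_or_ne a o with rfl | ha
  · have : sm a t a = a := by
      have := H.sm_nrm ht a
      rw [dist_self, mul_zero] at this
      exact (dist_eq_zero.1 this).symm
    rw [this, dist_self]; ring
  rcases eq_or_ne b o with rfl | hb
  · rw [dist_comm, H.sm_nrm ht, dist_comm a b, dist_self]; ring
  have hn := H.sm_nrm ht a
  have ha' : 0 < dist o a := dist_pos.2 ha.symm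
  have hta : sm o t a ≠ o := by
    intro h
    rw [h, dist_self] at hn
    have := mul_pos ht' ha'
    linarith
  have hd : dir o (sm o t a) = dir o a := by
    unfold dir
    rw [hn, H.sm_sm (by positivity) ht]
    congr 1; field_simp
  have e1 := H.ee_eq hta hb
  have e2 := H.ee_eq ha hb
  unfold ee at e1 e2
  rw [hd, hn] at e1
  rw [e1, e2, EE_sq, EE_sq]
  ring

end Good

namespace Good
variable {Y : Type u} [MetricSpace Y] {o : Y}

theorem lin_of_large {a b : ℝ} (h : ∀ R : ℝ, 1 ≤ R → R * a ≤ b) : a ≤ 0 := by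
  by_contra hc
  push Not at hc
  have h1 := h (max 1 ((|b| + 1) / a)) (le_max_left _ _)
  have h2 : (|b| + 1) / a * a ≤ max 1 ((|b| + 1) / a) * a := by
    gcongr
    exact le_max_right _ _
  rw [div_mul_cancel₀ _ hc.ne'] at h2
  have := le_abs_self b
  linarith

theorem cn (H : Good Y o) {l : ℝ} (hl0 : 0 ≤ l) (hl1 : l ≤ 1) {x y m : Y}
    (h1 : dist x m = l * dist x y) (h2 : dist m y = (1 - l) * dist x y) (z : Y) :
    dist m z ^ 2 ≤ (1 - l) * dist x z ^ 2 + l * dist y z ^ 2 - l * (1 - l) * dist x y ^ 2 := by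
  rcases hl0.eq_or_lt with rfl | hl0
  · have : x = m := by rw [← dist_eq_zero, h1]; ring
    subst this; simp
  rcases hl1.eq_or_lt with rfl | hl1
  · have : m = y := by rw [← dist_eq_zero, h2]; ring
    subst this; simp
  rcases (dist_nonneg (x := x) (y := y)).eq_or_lt with hd | hd
  · rw [← hd] at h1 h2
    have e1 : x = m := by rw [← dist_eq_zero, h1]; ring
    have e2 : m = y := by rw [← dist_eq_zero, h2]; ring
    subst e1; subst e2; simp; nlinarith [sq_nonneg (dist x z)]
  have key1 : ∀ R : ℝ, 0 ≤ R → dist (sm o R z) m ^ 2 ≤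
      (1 - l) * dist (sm o R z) x ^ 2 + l * dist (sm o R z) y ^ 2 := by
    intro R _
    set q := sm o R z
    have h := ptol_between H.ptol x y m q
    rw [h1, h2, dist_comm m q, dist_comm x q, dist_comm y q] at h
    have h' : dist q m ≤ (1 - l) * dist q x + l * dist q y := by
      have : dist q m * dist x y ≤ ((1 - l) * dist q x + l * dist q y) * dist x y := by
        nlinarith
      exact le_of_mul_le_mul_right this hd
    have h3 : dist q m ^ 2 ≤ ((1 - l) * dist q x + l * dist q y) ^ 2 := by
      gcongr
    nlinarith [mul_nonneg (mul_nonneg hl0.le (sub_nonneg.2 hl1.le)) (sq_nonneg (dist q x - dist q y))]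
  have key2 : (1 - l) * (dist o z ^2 + dist o x ^2 - dist z x ^2)
      + l * (dist o z ^2 + dist o y ^2 - dist z y ^2) - (dist o z ^2 + dist o m ^2 - dist z m ^2) ≤ 0 := by
    apply lin_of_large (b := (1 - l) * dist o x ^ 2 + l * dist o y ^ 2 - dist o m ^ 2)
    intro R hR
    have h := key1 R (by linarith)
    rw [H.cos_law (by linarith), H.cos_law (by linarith), H.cos_law (by linarith)] at h
    nlinarith
  -- quadratic
  have key3 : ∀ t : ℝ, 0 ≤ t → l * (1 - l) * dist x y ^ 2 ≤
      (1 - l) * dist (sm o t m) x ^ 2 + l * dist (sm o t m) y ^ 2 := by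
    intro t _
    set q := sm o t m
    have ht : dist x y ≤ dist q x + dist q y := by
      rw [dist_comm q x]; exact dist_triangle _ _ _
    have e : (1 - l) * dist q x ^ 2 + l * dist q y ^ 2 - l * (1 - l) * (dist q x + dist q y) ^ 2
        = ((1 - l) * dist q x - l * dist q y) ^ 2 := by ring
    have h3 : dist x y ^ 2 ≤ (dist q x + dist q y) ^ 2 := by gcongr
    have h4 : 0 < l * (1 - l) := mul_pos hl0 (by linarith)
    nlinarith [sq_nonneg ((1 - l) * dist q x - l * dist q y)]
  have e1 : (1 - l) * dist m x ^ 2 + l * dist m y ^ 2 = l * (1 - l) * dist x y ^ 2 := by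
    rw [dist_comm m x, h1, h2]; ring
  set J := (1 - l) * (dist o m ^2 + dist o x ^2 - dist m x ^2)
      + l * (dist o m ^2 + dist o y ^2 - dist m y ^2) with hJ
  have key4 : ∀ t : ℝ, 0 ≤ t → 0 ≤ (t ^ 2 - 1) * dist o m ^ 2 - (t - 1) * J := by
    intro t ht
    have h := key3 t ht
    rw [H.cos_law ht, H.cos_law ht] at h
    rw [hJ]
    nlinarith
  have key5 : J = 2 * dist o m ^ 2 := by
    by_contra hne
    set A := dist o m ^ 2 with hA
    have hA0 : 0 ≤ A := sq_nonneg _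
    -- at t = 1 + s : s * ((2 + s) A - J)
    have f : ∀ s : ℝ, -1 ≤ s → 0 ≤ s * (2 * A - J) + s ^ 2 * A := by
      intro s hs
      have := key4 (1 + s) (by linarith)
      nlinarith
    set D := 2 * A - J with hD
    have hD0 : D ≠ 0 := fun h => hne (by linarith)
    have hden : 0 < 2 * (A + |D|) := by have := abs_pos.2 hD0; linarith
    have hs : -1 ≤ -(D / (2 * (A + |D|))) := by
      rw [neg_le_neg_iff, div_le_one hden]
      have := le_abs_self D
      have := abs_nonneg D
      linarith
    have h := f _ hs
    have e : -(D / (2 * (A + |D|))) * D + (-(D / (2 * (A + |D|)))) ^ 2 * A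
        = - (D ^ 2 / (2 * (A + |D|)) ^ 2) * (A + 2 * |D|) := by
      field_simp
      ring
    rw [e] at h
    have h5 : 0 < D ^ 2 / (2 * (A + |D|)) ^ 2 := by positivity
    have h6 : 0 < A + 2 * |D| := by have := abs_pos.2 hD0; linarith
    nlinarith
  have e3 : dist o m ^ 2 = (1 - l) * dist o x ^ 2 + l * dist o y ^ 2 - l * (1 - l) * dist x y ^ 2 := by
    rw [hJ] at key5
    nlinarith
  rw [dist_comm m z, dist_comm x z, dist_comm y z]
  nlinarith

theorem thales (H : Good Y o) {l : ℝ} (hl0 : 0 ≤ l) (hl1 : l ≤ 1) {z x y a b : Y}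
    (h1 : dist z a = l * dist z x) (h2 : dist a x = (1 - l) * dist z x)
    (h3 : dist z b = l * dist z y) (h4 : dist b y = (1 - l) * dist z y) :
    dist a b ≤ l * dist x y := by
  have k1 := H.cn hl0 hl1 h1 h2 b
  have k2 := H.cn hl0 hl1 h3 h4 x
  rw [dist_comm b x, dist_comm y x] at k2
  rw [h3] at k1
  have : dist a b ^ 2 ≤ (l * dist x y) ^ 2 := by nlinarith
  exact (pow_le_pow_iff_left₀ dist_nonneg (mul_nonneg hl0 dist_nonneg) (by norm_num)).1 this

theorem point_at (H : Good Y o) {l : ℝ} (hl0 : 0 ≤ l) (hl1 : l ≤ 1) (x y : Y) :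
    ∃ n, dist x n = l * dist x y ∧ dist n y = (1 - l) * dist x y := by
  obtain ⟨f, hf, h0, hd⟩ := geodesic_of_mid H.proper H.mid x y
  have hd0 := dist_nonneg (x := x) (y := y)
  have m0 : (0:ℝ) ∈ Set.Icc 0 (dist x y) := ⟨le_rfl, hd0⟩
  have m1 : dist x y ∈ Set.Icc 0 (dist x y) := ⟨hd0, le_rfl⟩
  have ml : l * dist x y ∈ Set.Icc 0 (dist x y) := ⟨by positivity, by nlinarith⟩
  refine ⟨f (l * dist x y), ?_, ?_⟩
  · have := hf _ m0 _ ml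
    rw [h0, zero_sub, abs_neg, abs_of_nonneg ml.1] at this
    exact this
  · have := hf _ ml _ m1
    rw [hd, abs_sub_comm, abs_of_nonneg (by linarith [ml.2])] at this
    rw [this]; ring

theorem quad (H : Good Y o) {l : ℝ} (hl0 : 0 ≤ l) (hl1 : l ≤ 1) {x0 x1 y0 y1 a b : Y}
    (h1 : dist x0 a = l * dist x0 x1) (h2 : dist a x1 = (1 - l) * dist x0 x1)
    (h3 : dist y0 b = l * dist y0 y1) (h4 : dist b y1 = (1 - l) * dist y0 y1) :
    dist a b ≤ (1 - l) * dist x0 y0 + l * dist x1 y1 := by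
  obtain ⟨n, n1, n2⟩ := H.point_at hl0 hl1 x0 y1
  have k1 := H.thales hl0 hl1 h1 h2 n1 n2
  have k2 := H.thales (z := y1) (x := x0) (y := y0) (a := n) (b := b) (l := 1 - l)
    (by linarith) (by linarith) (by rw [dist_comm, n2, dist_comm x0]) (by rw [dist_comm, n1, dist_comm x0]; ring)
    (by rw [dist_comm, h4, dist_comm y0]) (by rw [dist_comm, h3, dist_comm y0]; ring)
  linarith [dist_triangle a n b]

theorem geodesic (H : Good Y o) : IsGeodesicSpace Y := by
  intro x y
  obtain ⟨f, hf, h0, hd⟩ := geodesic_of_mid H.proper H.mid x y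
  exact ⟨_, f, hf, rfl, h0, hd⟩

theorem busemann (H : Good Y o) : BusemannConvex Y := by
  rintro a b a' b' γ γ' ⟨c, hc, hγ⟩ ⟨c', hc', hγ'⟩
  refine ⟨(convex_Icc a b).prod (convex_Icc a' b'), ?_⟩
  rintro ⟨s, s'⟩ ⟨hs, hs'⟩ ⟨t, t'⟩ ⟨ht, ht'⟩ u v hu hv huv
  have aux : ∀ {a b : ℝ} {γ : ℝ → Y} {c : ℝ}, (∀ s ∈ Set.Icc a b, ∀ t ∈ Set.Icc a b,
      dist (γ s) (γ t) = c * |s - t|) → ∀ s ∈ Set.Icc a b, ∀ t ∈ Set.Icc a b,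
      dist (γ s) (γ (u * s + v * t)) = v * dist (γ s) (γ t) ∧
      dist (γ (u * s + v * t)) (γ t) = (1 - v) * dist (γ s) (γ t) := by
    intro a b γ c h s hs t ht
    have hm : u * s + v * t ∈ Set.Icc a b := (convex_Icc a b) hs ht hu hv huv
    have hu' : u = 1 - v := by linarith
    rw [h _ hs _ hm, h _ hm _ ht, h _ hs _ ht]
    constructor
    · rw [show s - (u * s + v * t) = v * (s - t) by rw [hu']; ring, abs_mul, abs_of_nonneg hv]; ring
    · rw [show u * s + v * t - t = u * (s - t) by rw [hu']; ring, abs_mul, abs_of_nonneg hu, hu']; ring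
  obtain ⟨e1, e2⟩ := aux hγ s hs t ht
  obtain ⟨e3, e4⟩ := aux hγ' s' hs' t' ht'
  have := H.quad hv (by linarith) e1 e2 e3 e4
  simp only [Prod.smul_mk, Prod.mk_add_mk, smul_eq_mul]
  rw [show u = 1 - v by linarith] at this ⊢
  exact this

end Good

section SeqTools
variable {X : Type u} [MetricSpace X] {p : X} {r : ℕ → ℝ} {F : Set (ℕ → X)}

theorem diag {ι : Type*} [Countable ι] (f : ι → ℕ → ℝ) (hb : ∀ i, ∃ C, ∀ n, |f i n| ≤ C) :
    ∃ φ : ℕ → ℕ, StrictMono φ ∧ ∀ i, ∃ L, Tendsto (fun n => f i (φ n)) atTop (𝓝 L) := by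
  choose C hC using hb
  have hK : IsCompact (Set.univ.pi fun i => Set.Icc (-C i) (C i)) :=
    isCompact_univ_pi fun i => isCompact_Icc
  obtain ⟨a, _, φ, hφ, h⟩ := hK.tendsto_subseq (x := fun n i => f i n)
    (fun n i _ => abs_le.1 (hC i n))
  exact ⟨φ, hφ, fun i => ⟨a i, (tendsto_pi_nhds.1 h) i⟩⟩

theorem conv_of_approx {f : ℕ → ℝ} (h : ∀ ε > 0, ∃ g : ℕ → ℝ, (∃ L, Tendsto g atTop (𝓝 L)) ∧
    ∀ᶠ n in atTop, |f n - g n| < ε) : ∃ L, Tendsto f atTop (𝓝 L) := by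
  apply cauchySeq_tendsto_of_complete
  rw [Metric.cauchySeq_iff']
  intro ε hε
  obtain ⟨g, ⟨L, hL⟩, hg⟩ := h (ε/4) (by linarith)
  have h1 := Metric.tendsto_nhds.1 hL (ε/4) (by linarith)
  obtain ⟨N, hN⟩ := eventually_atTop.1 (hg.and h1)
  refine ⟨N, fun n hn => ?_⟩
  have a := hN n hn
  have b := hN N le_rfl
  rw [Real.dist_eq] at a b ⊢
  rw [abs_lt] at *
  constructor <;> linarith [a.1.1, a.1.2, (abs_lt.1 a.2).1, (abs_lt.1 a.2).2, b.1.1, b.1.2, (abs_lt.1 b.2).1, (abs_lt.1 b.2).2]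

theorem MutuallyStable.symm {x y : ℕ → X} (h : MutuallyStable r x y) : MutuallyStable r y x := by
  obtain ⟨L, h⟩ := h
  exact ⟨L, by simpa only [dist_comm] using h⟩

theorem MutuallyStable.refl (x : ℕ → X) : MutuallyStable r x x := ⟨0, by simp⟩

theorem MutuallyStable.comp {x y : ℕ → X} (h : MutuallyStable r x y) {φ : ℕ → ℕ} (hφ : StrictMono φ) :
    MutuallyStable (r ∘ φ) (x ∘ φ) (y ∘ φ) := by
  obtain ⟨L, h⟩ := h
  exact ⟨L, h.comp hφ.tendsto_atTop⟩

theorem IsNormalizingSeq.comp (h : IsNormalizingSeq r) {φ : ℕ → ℕ} (hφ : StrictMono φ) :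
    IsNormalizingSeq (r ∘ φ) := ⟨fun n => h.1 _, h.2.comp hφ.tendsto_atTop⟩

/-- bounded relative to r -/
def Bdd (p : X) (r : ℕ → ℝ) (x : ℕ → X) : Prop := ∃ C, ∀ n, dist (x n) p / r n ≤ C

theorem quot_sub_le (hr : ∀ n, 0 < r n) (x y z : ℕ → X) (n : ℕ) :
    |dist (x n) (z n) / r n - dist (y n) (z n) / r n| ≤ dist (x n) (y n) / r n := by
  rw [← sub_div, abs_div, abs_of_pos (hr n)]
  have := hr n
  gcongr
  exact abs_dist_sub_le _ _ _

theorem stable_of_dense (hr : ∀ n, 0 < r n) {y z : ℕ → X}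
    (h : ∀ ε > 0, ∃ q : ℕ → X, MutuallyStable r q z ∧ ∀ᶠ n in atTop, dist (y n) (q n) / r n < ε) :
    MutuallyStable r y z := by
  apply conv_of_approx
  intro ε hε
  obtain ⟨q, hq, h⟩ := h ε hε
  exact ⟨_, hq, h.mono fun n hn => (quot_sub_le hr y q z n).trans_lt hn⟩

theorem mem_of_stable (hF : MaximalSelfStable p r F) {y : ℕ → X}
    (h : ∀ x ∈ F, MutuallyStable r x y) : y ∈ F := by
  have : insert y F = F := by
    apply hF.2.2 _ _ (Set.subset_insert _ _)
    rintro a (rfl | ha) b (rfl | hb)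
    · exact .refl _
    · exact (h _ hb).symm
    · exact h _ ha
    · exact hF.1 _ ha _ hb
  rw [← this]; exact Set.mem_insert _ _

theorem mem_of_dense (hr : ∀ n, 0 < r n) (hF : MaximalSelfStable p r F) {y : ℕ → X}
    (h : ∀ ε > 0, ∃ q ∈ F, ∀ᶠ n in atTop, dist (y n) (q n) / r n < ε) : y ∈ F := by
  refine mem_of_stable hF fun x hx => ?_
  refine (stable_of_dense hr fun ε hε => ?_).symm
  obtain ⟨q, hq, h⟩ := h ε hε
  exact ⟨q, hF.1 _ hq _ hx, h⟩

theorem exists_maximal {G : Set (ℕ → X)} (hG : SelfStable r G) (hp : (fun _ => p) ∈ G) :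
    ∃ F, MaximalSelfStable p r F ∧ G ⊆ F := by
  obtain ⟨F, hGF, hF⟩ := zorn_subset_nonempty {F : Set (ℕ → X) | SelfStable r F} (by
    intro c hc hch _
    refine ⟨⋃₀ c, ?_, fun s hs => Set.subset_sUnion_of_mem hs⟩
    rintro x ⟨s, hs, hx⟩ y ⟨t, ht, hy⟩
    rcases hch.total hs ht with h | h
    · exact hc ht x (h hx) y hy
    · exact hc hs x hx y (h hy)) G hG
  exact ⟨F, ⟨hF.prop, hGF hp, fun K hK hFK => (hF.eq_of_subset hK hFK).symm⟩, hGF⟩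

theorem bdd_of_mem (hF : MaximalSelfStable p r F) {x : ℕ → X} (hx : x ∈ F) : Bdd p r x := by
  obtain ⟨L, hL⟩ := hF.1 x hx _ hF.2.1
  obtain ⟨C, hC⟩ := hL.bddAbove_range
  exact ⟨C, fun n => hC ⟨n, rfl⟩⟩

theorem bdd_pair (hr : ∀ n, 0 < r n) {x y : ℕ → X} (hx : Bdd p r x) (hy : Bdd p r y) :
    ∃ C, ∀ n, |dist (x n) (y n) / r n| ≤ C := by
  obtain ⟨A, hA⟩ := hx
  obtain ⟨B, hB⟩ := hy
  refine ⟨A + B, fun n => ?_⟩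
  have := hr n
  rw [abs_of_nonneg (by positivity)]
  refine le_trans ?_ (add_le_add (hA n) (hB n))
  rw [← add_div]
  gcongr
  exact dist_triangle_right _ _ _

theorem exists_subseq_maximal (hr : ∀ n, 0 < r n) {ι : Type*} [Countable ι] (z : ι → ℕ → X)
    (hz : ∀ i, Bdd p r (z i)) : ∃ φ : ℕ → ℕ, StrictMono φ ∧ ∃ F, MaximalSelfStable p (r ∘ φ) F ∧
      ∀ i, z i ∘ φ ∈ F := by
  have hp : Bdd p r (fun _ => p) := ⟨0, by simp⟩
  let w : Option ι → ℕ → X := fun o => o.elim (fun _ => p) z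
  have hw : ∀ i, Bdd p r (w i) := by rintro (_ | i); exacts [hp, hz i]
  obtain ⟨φ, hφ, h⟩ := diag (fun (ij : Option ι × Option ι) n => dist (w ij.1 n) (w ij.2 n) / r n)
    (fun ij => bdd_pair hr (hw _) (hw _))
  obtain ⟨F, hF, hG⟩ := exists_maximal (p := p) (r := r ∘ φ) (G := Set.range fun i => w i ∘ φ) (by
    rintro _ ⟨i, rfl⟩ _ ⟨j, rfl⟩
    exact h (i, j)) ⟨none, rfl⟩
  exact ⟨φ, hφ, F, hF, fun i => hG ⟨some i, rfl⟩⟩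

/-- dense countable family -/
def Dn (r : ℕ → ℝ) (F : Set (ℕ → X)) (q : ℕ → ℕ → X) : Prop :=
  (∀ i, q i ∈ F) ∧ ∀ x ∈ F, ∀ ε > 0, ∃ i, ∀ᶠ n in atTop, dist (x n) (q i n) / r n < ε

/-- Every maximal family is tangent and separable -/
def HS (p : X) : Prop := ∀ (r : ℕ → ℝ) (F : Set (ℕ → X)), IsNormalizingSeq r → MaximalSelfStable p r F →
  IsTangentFamily p r F ∧ ∃ q, Dn r F q

theorem lemB (hr : ∀ n, 0 < r n) (hF : MaximalSelfStable p r F) {q : ℕ → ℕ → X} (hq : Dn r F q)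
    {ι : Type*} [Countable ι] (z : ι → ℕ → X)
    (hz : ∀ i, Bdd p r (z i)) : ∃ φ : ℕ → ℕ, StrictMono φ ∧ ∃ F', MaximalSelfStable p (r ∘ φ) F' ∧
      (∀ x ∈ F, x ∘ φ ∈ F') ∧ ∀ i, z i ∘ φ ∈ F' := by
  obtain ⟨φ, hφ, F', hF', h⟩ := exists_subseq_maximal (p := p) hr (Sum.elim q z)
    (by rintro (i | i); exacts [bdd_of_mem hF (hq.1 i), hz i])
  refine ⟨φ, hφ, F', hF', fun x hx => ?_, fun i => h (Sum.inr i)⟩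
  refine mem_of_dense (fun n => hr _) hF' fun ε hε => ?_
  obtain ⟨i, hi⟩ := hq.2 x hx ε hε
  exact ⟨_, h (Sum.inl i), hφ.tendsto_atTop.eventually hi⟩

theorem HS.extract (hs : HS p) (hr : IsNormalizingSeq r) (hF : MaximalSelfStable p r F)
    {z : ℕ → X} (hz : Bdd p r z) : ∃ φ : ℕ → ℕ, StrictMono φ ∧ ∃ x ∈ F,
      Tendsto (fun k => dist (x (φ k)) (z (φ k)) / r (φ k)) atTop (𝓝 0) := by
  obtain ⟨ht, q, hq⟩ := hs r F hr hF
  obtain ⟨φ, hφ, F', hF', h1, h2⟩ := lemB hr.1 hF hq (fun _ : Unit => z) (fun _ => hz)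
  exact ⟨φ, hφ, ht φ hφ F' hF' h1 _ (h2 ())⟩

theorem exists_sepq (T : Type u) (ps : PseudoMetricSpace T) :
    ∃ (Ω : Type u) (_ : MetricSpace Ω) (mk : T → Ω), Function.Surjective mk ∧
      ∀ x y, dist (mk x) (mk y) = dist x y :=
  ⟨SeparationQuotient T, inferInstance, SeparationQuotient.mk, SeparationQuotient.surjective_mk,
    fun x y => SeparationQuotient.dist_mk x y⟩

theorem exists_pretangent (hr : IsNormalizingSeq r) (hF : MaximalSelfStable p r F) :
    ∃ (Ω : Type u) (_ : MetricSpace Ω) (π : (ℕ → X) → Ω), IsPretangentSpace p r F π := by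
  classical
  choose L hL using hF.1
  let ps : PseudoMetricSpace F :=
    { dist := fun x y => L x.1 x.2 y.1 y.2
      dist_self := fun x => tendsto_nhds_unique (hL x.1 x.2 x.1 x.2) (by simp)
      dist_comm := fun x y => tendsto_nhds_unique (hL x.1 x.2 y.1 y.2)
        (by simpa only [dist_comm] using hL y.1 y.2 x.1 x.2)
      dist_triangle := fun x y z => le_of_tendsto_of_tendsto' (hL x.1 x.2 z.1 z.2)
        ((hL x.1 x.2 y.1 y.2).add (hL y.1 y.2 z.1 z.2)) (fun n => by
          rw [← add_div]
          have := hr.1 n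
          gcongr
          exact dist_triangle _ _ _) }
  obtain ⟨Ω, hΩ, mk, hmk, hd⟩ := exists_sepq F ps
  refine ⟨Ω, hΩ, fun x => if h : x ∈ F then mk ⟨x, h⟩ else mk ⟨_, hF.2.1⟩, hr, hF, ?_, ?_⟩
  · intro ω
    obtain ⟨⟨x, hx⟩, rfl⟩ := hmk ω
    exact ⟨x, hx, by simp [hx]⟩
  · intro x hx y hy
    simp only [hx, hy, dif_pos, hd]
    exact hL x hx y hy

theorem HS_of (hst : ∀ (r : ℕ → ℝ) (F : Set (ℕ → X)) (Ω : Type u) [MetricSpace Ω]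
      (π : (ℕ → X) → Ω), IsPretangentSpace p r F π →
      TopologicalSpace.SeparableSpace Ω ∧ IsTangentFamily p r F) : HS p := by
  intro r F hr hF
  obtain ⟨Ω, _, π, h⟩ := exists_pretangent hr hF
  obtain ⟨hsep, ht⟩ := hst r F Ω π h
  refine ⟨ht, ?_⟩
  have : Nonempty Ω := ⟨π fun _ => p⟩
  choose s hs1 hs2 using h.2.2.1
  refine ⟨fun i => s (TopologicalSpace.denseSeq Ω i), fun i => hs1 _, fun x hx ε hε => ?_⟩
  obtain ⟨i, hi⟩ := (TopologicalSpace.denseRange_denseSeq Ω).exists_dist_lt (π x) hε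
  refine ⟨i, ?_⟩
  have := h.2.2.2 x hx _ (hs1 (TopologicalSpace.denseSeq Ω i))
  rw [hs2] at this
  exact this.eventually (gt_mem_nhds hi)

end SeqTools

section Tools2
variable {X : Type u} [MetricSpace X] {p : X}

theorem midQuot_nonneg (w x y z : X) : 0 ≤ midQuot p w x y z := by
  unfold midQuot
  split_ifs
  · exact le_rfl
  · exact le_top
  · exact_mod_cast div_nonneg (abs_nonneg _) (le_max_of_le_left dist_nonneg)

theorem max_pos_of {x y : X} (h : ¬ (x = p ∧ y = p)) : 0 < max (dist x p) (dist y p) := by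
  by_contra hc
  push Not at hc
  have h1 := (le_max_left _ _).trans hc
  have h2 := (le_max_right _ _).trans hc
  exact h ⟨dist_le_zero.1 h1, dist_le_zero.1 h2⟩

theorem midQuot_le {w x y z : X} (hw : w = x ∨ w = y) (ε : ℝ) (hε : 0 < ε) :
    midQuot p w x y z ≤ (ε : EReal) ↔ |dist w z - dist x y / 2| ≤ ε * max (dist x p) (dist y p) := by
  unfold midQuot
  split_ifs with h h'
  · have hwp : w = p := by rcases hw with e | e <;> rw [e] <;> simp [h]
    simp [h, h', hwp, hε.le]
  · have hwp : w = p := by rcases hw with e | e <;> rw [e] <;> simp [h]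
    have : p ≠ z := fun h => h' h.symm
    simp [h, hwp, this]
  · rw [EReal.coe_le_coe_iff, div_le_iff₀ (max_pos_of h)]

theorem ereal_tendsto_zero {f : ℕ → EReal} (h0 : ∀ n, 0 ≤ f n) :
    Tendsto f atTop (𝓝 0) ↔ ∀ ε : ℝ, 0 < ε → ∀ᶠ n in atTop, f n ≤ (ε : EReal) := by
  constructor
  · intro h ε hε
    exact (h.eventually (gt_mem_nhds (show (0:EReal) < (ε:EReal) by exact_mod_cast hε))).mono
      fun n hn => hn.le
  · intro h
    rw [tendsto_order]
    refine ⟨fun a ha => Eventually.of_forall fun n => ha.trans_le (h0 n), fun a ha => ?_⟩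
    obtain ⟨e, he, hea⟩ := EReal.lt_iff_exists_real_btwn.1 ha
    exact (h e (by exact_mod_cast he)).mono fun n hn => hn.trans_lt hea

theorem infmid_iff {x y z : ℕ → X} : IsInfinitesimalMidpoint p x y z ↔ ∀ ε : ℝ, 0 < ε → ∀ᶠ n in atTop,
    |dist (x n) (z n) - dist (x n) (y n) / 2| ≤ ε * max (dist (x n) p) (dist (y n) p) ∧
    |dist (y n) (z n) - dist (x n) (y n) / 2| ≤ ε * max (dist (x n) p) (dist (y n) p) := by
  unfold IsInfinitesimalMidpoint
  rw [ereal_tendsto_zero fun n => midQuot_nonneg _ _ _ _,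
    ereal_tendsto_zero fun n => midQuot_nonneg _ _ _ _]
  constructor
  · rintro ⟨h1, h2⟩ ε hε
    filter_upwards [h1 ε hε, h2 ε hε] with n a b
    exact ⟨(midQuot_le (.inl rfl) ε hε).1 a, (midQuot_le (.inr rfl) ε hε).1 b⟩
  · intro h
    exact ⟨fun ε hε => (h ε hε).mono fun n hn => (midQuot_le (.inl rfl) ε hε).2 hn.1,
      fun ε hε => (h ε hε).mono fun n hn => (midQuot_le (.inr rfl) ε hε).2 hn.2⟩

theorem delta4_bounds (w x y z : X) : dist w p ≤ delta4 p w x y z ∧ dist x p ≤ delta4 p w x y z ∧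
    dist y p ≤ delta4 p w x y z ∧ dist z p ≤ delta4 p w x y z := by
  unfold delta4
  refine ⟨le_max_left _ _, ?_, ?_, ?_⟩
  · exact le_max_of_le_right (le_max_left _ _)
  · exact le_max_of_le_right (le_max_of_le_right (le_max_left _ _))
  · exact le_max_of_le_right (le_max_of_le_right (le_max_right _ _))

theorem delta4_pos {w x y z : X} (h : ¬ (w = p ∧ x = p ∧ y = p ∧ z = p)) : 0 < delta4 p w x y z := by
  by_contra hc
  push Not at hc
  obtain ⟨h1, h2, h3, h4⟩ := delta4_bounds (p := p) w x y z
  exact h ⟨dist_le_zero.1 (h1.trans hc), dist_le_zero.1 (h2.trans hc), dist_le_zero.1 (h3.trans hc),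
    dist_le_zero.1 (h4.trans hc)⟩

theorem A3_ge {w x y z : X} {ε : ℝ} (hε : 0 ≤ ε) : -ε ≤ A3 p w x y z ↔
    dist x y * dist w z ≤ dist x w * dist y z + dist x z * dist y w + ε * delta4 p w x y z ^ 2 := by
  unfold A3
  split_ifs with h
  · obtain ⟨rfl, rfl, rfl, rfl⟩ := h
    simp [hε, delta4]
  · have := delta4_pos h
    rw [le_div_iff₀ (by positivity)]
    constructor <;> intro h <;> nlinarith

theorem dist_le_two {x y : X} {D : ℝ} (hx : dist x p ≤ D) (hy : dist y p ≤ D) : dist x y ≤ 2 * D := by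
  linarith [dist_triangle_right x y p]

theorem A3_lower (w x y z : X) : -4 ≤ A3 p w x y z := by
  rw [A3_ge (by norm_num)]
  obtain ⟨h1, h2, h3, h4⟩ := delta4_bounds (p := p) w x y z
  have hD : 0 ≤ delta4 p w x y z := dist_nonneg.trans h1
  have a := mul_le_mul (dist_le_two h2 h3) (dist_le_two h1 h4) dist_nonneg (by linarith)
  have b : 0 ≤ dist x w * dist y z + dist x z * dist y w := by positivity
  nlinarith

theorem A3_upper (w x y z : X) : A3 p w x y z ≤ 8 := by
  unfold A3
  split_ifs with h
  · norm_num
  · have hD := delta4_pos h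
    rw [div_le_iff₀ (by positivity)]
    obtain ⟨h1, h2, h3, h4⟩ := delta4_bounds (p := p) w x y z
    have a := mul_le_mul (dist_le_two h2 h1) (dist_le_two h3 h4) dist_nonneg (by linarith)
    have a' := mul_le_mul (dist_le_two h2 h4) (dist_le_two h3 h1) dist_nonneg (by linarith)
    have b : 0 ≤ dist x y * dist w z := by positivity
    nlinarith

theorem liminf_A3_iff : 0 ≤ liminf (fun q : X × X × X × X => A3 p q.1 q.2.1 q.2.2.1 q.2.2.2)
            (𝓝 (p, p, p, p)) ↔ ∀ ε : ℝ, 0 < ε → ∀ᶠ q : X × X × X × X in 𝓝 (p, p, p, p),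
      -ε ≤ A3 p q.1 q.2.1 q.2.2.1 q.2.2.2 := by
  constructor
  · intro h ε hε
    have := eventually_lt_of_lt_liminf (show -ε < _ from lt_of_lt_of_le (by linarith) h)
      (by exact isBoundedUnder_of ⟨-4, fun q => A3_lower _ _ _ _⟩)
    exact this.mono fun q hq => hq.le
  · intro h
    refine le_of_forall_pos_le_add fun ε hε => ?_
    have := le_liminf_of_le (a := -ε)
      (IsBoundedUnder.isCoboundedUnder_ge (isBoundedUnder_of ⟨8, fun q => A3_upper _ _ _ _⟩)) (h ε hε)
    linarith

theorem tendsto_p_of_bdd {r : ℕ → ℝ} (hr : IsNormalizingSeq r) {x : ℕ → X} (h : Bdd p r x) :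
    Tendsto x atTop (𝓝 p) := by
  obtain ⟨C, hC⟩ := h
  rw [tendsto_iff_dist_tendsto_zero]
  refine squeeze_zero (fun _ => dist_nonneg) (fun n => (div_le_iff₀ (hr.1 n)).1 (hC n)) ?_
  simpa using hr.2.const_mul C

theorem HS.extract' (hs : HS p) {r : ℕ → ℝ} {F : Set (ℕ → X)} (hr : IsNormalizingSeq r)
    (hF : MaximalSelfStable p r F) {ψ : ℕ → ℕ} (hψ : StrictMono ψ)
    {z : ℕ → X} (hz : Bdd p (r ∘ ψ) z) : ∃ φ : ℕ → ℕ, StrictMono φ ∧ ∃ x ∈ F,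
      Tendsto (fun k => dist (x (ψ (φ k))) (z (φ k)) / r (ψ (φ k))) atTop (𝓝 0) := by
  obtain ⟨F1, hF1, hsub⟩ := exists_maximal (p := p) (r := r ∘ ψ) (G := (fun x => x ∘ ψ) '' F) (by
    rintro _ ⟨x, hx, rfl⟩ _ ⟨y, hy, rfl⟩
    exact (hF.1 x hx y hy).comp hψ) ⟨_, hF.2.1, rfl⟩
  obtain ⟨_, q, hq⟩ := hs _ F1 (hr.comp hψ) hF1
  obtain ⟨φ, hφ, F', hF', h1, h2⟩ := lemB (hr.comp hψ).1 hF1 hq (fun _ : Unit => z) (fun _ => hz)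
  refine ⟨φ, hφ, ?_⟩
  exact (hs r F hr hF).1 (ψ ∘ φ) (hψ.comp hφ) F' hF' (fun x hx => h1 _ (hsub ⟨x, hx, rfl⟩)) _ (h2 ())

theorem bdd_of_eventually {r : ℕ → ℝ} {x : ℕ → X} {C : ℝ}
    (h : ∀ᶠ n in atTop, dist (x n) p / r n ≤ C) : Bdd p r x := by
  have : IsBoundedUnder (· ≤ ·) atTop (fun n => dist (x n) p / r n) := ⟨C, h⟩
  obtain ⟨D, hD⟩ := this.bddAbove_range
  exact ⟨D, fun n => hD ⟨n, rfl⟩⟩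

theorem stable_scale {r : ℕ → ℝ} {c : ℝ} {x y : ℕ → X} (h : MutuallyStable r x y) :
    MutuallyStable (fun n => c * r n) x y := by
  obtain ⟨L, h⟩ := h
  refine ⟨c⁻¹ * L, (h.const_mul c⁻¹).congr fun n => ?_⟩
  simp only [div_eq_mul_inv, mul_inv]; ring

theorem maximal_scale {r : ℕ → ℝ} {c : ℝ} (hc : 0 < c) {F : Set (ℕ → X)} (h : MaximalSelfStable p r F) :
    MaximalSelfStable p (fun n => c * r n) F := by
  refine ⟨fun x hx y hy => stable_scale (h.1 x hx y hy), h.2.1, fun G hG hFG => h.2.2 G ?_ hFG⟩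
  intro x hx y hy
  have := stable_scale (c := c⁻¹) (hG x hx y hy)
  simpa [inv_mul_cancel_left₀ hc.ne'] using this

end Tools2

section Main1
variable {X : Type u} [MetricSpace X] {p : X} {r : ℕ → ℝ} {F : Set (ℕ → X)}
  {Ω : Type u} [MetricSpace Ω] {π : (ℕ → X) → Ω}

theorem ptol_of (hP : IsPretangentSpace p r F π)
    (hA : ∀ ε : ℝ, 0 < ε → ∀ᶠ q : X × X × X × X in 𝓝 (p, p, p, p),
      -ε ≤ A3 p q.1 q.2.1 q.2.2.1 q.2.2.2) : Ptolemaic Ω := by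
  obtain ⟨hr, hF, hsur, hd⟩ := hP
  intro a b c d
  obtain ⟨x, hx, rfl⟩ := hsur a
  obtain ⟨y, hy, rfl⟩ := hsur b
  obtain ⟨w, hw, rfl⟩ := hsur c
  obtain ⟨z, hz, rfl⟩ := hsur d
  obtain ⟨Cx, hCx⟩ := bdd_of_mem hF hx
  obtain ⟨Cy, hCy⟩ := bdd_of_mem hF hy
  obtain ⟨Cw, hCw⟩ := bdd_of_mem hF hw
  obtain ⟨Cz, hCz⟩ := bdd_of_mem hF hz
  set M := max (max Cx Cy) (max Cw Cz) with hM
  have mx : Cx ≤ M := by simp [hM]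
  have my : Cy ≤ M := by simp [hM]
  have mw : Cw ≤ M := by simp [hM]
  have mz : Cz ≤ M := by simp [hM]
  have hM0 : 0 ≤ M := le_trans (div_nonneg dist_nonneg (hr.1 0).le) ((hCx 0).trans mx)
  have key : ∀ ε > 0, dist (π x) (π y) * dist (π w) (π z) ≤
      dist (π x) (π w) * dist (π y) (π z) + dist (π x) (π z) * dist (π y) (π w) + ε * M ^ 2 := by
    intro ε hε
    have ht : Tendsto (fun n => (w n, x n, y n, z n)) atTop (𝓝 (p, p, p, p)) :=
      (tendsto_p_of_bdd hr ⟨_, hCw⟩).prodMk_nhds ((tendsto_p_of_bdd hr ⟨_, hCx⟩).prodMk_nhds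
        ((tendsto_p_of_bdd hr ⟨_, hCy⟩).prodMk_nhds (tendsto_p_of_bdd hr ⟨_, hCz⟩)))
    refine le_of_tendsto_of_tendsto ((hd x hx y hy).mul (hd w hw z hz))
      ((((hd x hx w hw).mul (hd y hy z hz)).add ((hd x hx z hz).mul (hd y hy w hw))).add_const (ε * M ^ 2)) ?_
    filter_upwards [ht.eventually (hA ε hε)] with n hn
    rw [A3_ge hε.le] at hn
    have hrn := hr.1 n
    have hδ : delta4 p (w n) (x n) (y n) (z n) ≤ M * r n := by
      unfold delta4
      refine max_le ?_ (max_le ?_ (max_le ?_ ?_)) <;> rw [← div_le_iff₀ hrn]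
      exacts [(hCw n).trans mw, (hCx n).trans mx, (hCy n).trans my, (hCz n).trans mz]
    have hδ0 : 0 ≤ delta4 p (w n) (x n) (y n) (z n) := dist_nonneg.trans (delta4_bounds _ _ _ _).1
    have hδ2 : delta4 p (w n) (x n) (y n) (z n) ^ 2 ≤ (M * r n) ^ 2 := by gcongr
    have e : ∀ a b : ℝ, a / r n * (b / r n) = a * b / r n ^ 2 := by intro a b; field_simp
    rw [e, e, e, ← add_div, div_add' _ _ _ (by positivity)]
    gcongr
    nlinarith
  refine le_of_forall_pos_le_add fun ε hε => ?_
  have := key (ε / (M ^ 2 + 1)) (by positivity)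
  have h2 : ε / (M ^ 2 + 1) * M ^ 2 ≤ ε := by
    rw [div_mul_eq_mul_div, div_le_iff₀ (by positivity)]; nlinarith
  linarith

theorem mid_of (hs : HS p) (hP : IsPretangentSpace p r F π) (hm : MidpointConvexAt p) (a b : Ω) :
    ∃ m, IsMidpointOf m a b := by
  obtain ⟨hr, hF, hsur, hd⟩ := hP
  obtain ⟨x, hx, rfl⟩ := hsur a
  obtain ⟨y, hy, rfl⟩ := hsur b
  have hbx := bdd_of_mem hF hx
  have hby := bdd_of_mem hF hy
  obtain ⟨z, hz⟩ := hm x y (tendsto_p_of_bdd hr hbx) (tendsto_p_of_bdd hr hby)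
  rw [infmid_iff] at hz
  obtain ⟨Cx, hCx⟩ := hbx
  obtain ⟨Cy, hCy⟩ := hby
  set M := max Cx Cy with hM
  have hmax : ∀ n, max (dist (x n) p) (dist (y n) p) ≤ M * r n := by
    intro n
    refine max_le ?_ ?_ <;> rw [← div_le_iff₀ (hr.1 n)]
    exacts [(hCx n).trans (le_max_left _ _), (hCy n).trans (le_max_right _ _)]
  have hM0 : 0 ≤ M := le_trans (div_nonneg dist_nonneg (hr.1 0).le) ((hCx 0).trans (le_max_left _ _))
  have lim : ∀ u : ℕ → X, (∀ ε : ℝ, 0 < ε → ∀ᶠ n in atTop,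
      |dist (u n) (z n) - dist (x n) (y n) / 2| ≤ ε * max (dist (x n) p) (dist (y n) p)) →
      Tendsto (fun n => dist (u n) (z n) / r n) atTop (𝓝 (dist (π x) (π y) / 2)) := by
    intro u hu
    have h0 : Tendsto (fun n => (dist (u n) (z n) - dist (x n) (y n) / 2) / r n) atTop (𝓝 0) := by
      rw [Metric.tendsto_nhds]
      intro ε hε
      filter_upwards [hu (ε / (2 * (M + 1))) (by positivity)] with n hn
      have hrn := hr.1 n
      rw [Real.dist_eq, sub_zero, abs_div, abs_of_pos hrn, div_lt_iff₀ hrn]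
      refine hn.trans_lt ?_
      have h1 := mul_le_mul_of_nonneg_left (hmax n) (show 0 ≤ ε / (2 * (M + 1)) by positivity)
      refine h1.trans_lt ?_
      rw [← mul_assoc]
      refine mul_lt_mul_of_pos_right ?_ hrn
      rw [div_mul_eq_mul_div, div_lt_iff₀ (by positivity)]
      nlinarith
    have := h0.add ((hd x hx y hy).div_const 2)
    rw [zero_add] at this
    refine this.congr fun n => ?_
    ring
  have lx := lim x fun ε hε => (hz ε hε).mono fun n hn => hn.1
  have ly := lim y fun ε hε => (hz ε hε).mono fun n hn => hn.2
  have hbz : Bdd p r z := by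
    apply bdd_of_eventually (C := Cx + (dist (π x) (π y) / 2 + 1))
    filter_upwards [lx.eventually (gt_mem_nhds (lt_add_one _))] with n hn
    have hrn := hr.1 n
    refine le_trans ?_ (add_le_add (hCx n) hn.le)
    rw [← add_div]
    gcongr
    linarith [dist_triangle_left (z n) p (x n)]
  obtain ⟨φ, hφ, m, hmF, hlim⟩ := hs.extract hr hF hbz
  have fin : ∀ u ∈ F, Tendsto (fun n => dist (u n) (z n) / r n) atTop (𝓝 (dist (π x) (π y) / 2)) →
      dist (π m) (π u) = dist (π x) (π y) / 2 := by
    intro u hu h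
    have h1 := (hd m hmF u hu).comp hφ.tendsto_atTop
    have h2 := h.comp hφ.tendsto_atTop
    have h3 : Tendsto (fun k => dist (m (φ k)) (u (φ k)) / r (φ k) - dist (u (φ k)) (z (φ k)) / r (φ k))
        atTop (𝓝 0) := by
      refine squeeze_zero_norm (fun k => ?_) hlim
      have := quot_sub_le hr.1 m z u (φ k)
      rw [dist_comm (z (φ k)) (u (φ k))] at this
      simpa using this
    have h4 := tendsto_nhds_unique (h1.sub h2) h3
    linarith
  exact ⟨π m, fin x hx lx, fin y hy ly⟩

theorem proper_of (hs : HS p) (hP : IsPretangentSpace p r F π) : ProperSpace Ω := by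
  obtain ⟨hr, hF, hsur, hd⟩ := hP
  set o := π fun _ => p
  refine ⟨fun x0 R => ?_⟩
  apply IsSeqCompact.isCompact
  intro ω hω
  choose x hxF hxω using fun k => hsur (ω k)
  obtain ⟨_, q, hq⟩ := hs r F hr hF
  have ev : ∀ k, ∀ᶠ n in atTop, (∀ i ∈ Finset.range (k+1), |dist (x k n) (q i n) / r n - dist (ω k) (π (q i))| < 1 / ((k:ℝ)+1))
      ∧ dist (x k n) p / r n < dist (ω k) o + 1 := by
    intro k
    refine Eventually.and ?_ ?_
    · rw [Filter.eventually_all_finset]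
      intro i _
      have := hd _ (hxF k) _ (hq.1 i)
      rw [hxω] at this
      exact Metric.tendsto_nhds.1 this _ (by positivity)
    · have := hd _ (hxF k) _ hF.2.1
      rw [hxω] at this
      exact this.eventually (gt_mem_nhds (lt_add_one _))
  obtain ⟨N, hN, hN'⟩ := extraction_forall_of_eventually ev
  have hb : Bdd p (r ∘ N) (fun k => x k (N k)) := by
    refine ⟨R + dist x0 o + 1, fun k => ?_⟩
    have h1 := (hN' k).2
    have h2 := dist_triangle (ω k) x0 o
    have h3 := hω k
    rw [Metric.mem_closedBall] at h3
    simp only [Function.comp]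
    linarith
  obtain ⟨φ, hφ, w, hw, hlim⟩ := hs.extract' hr hF hN hb
  have hconv : Tendsto (ω ∘ φ) atTop (𝓝 (π w)) := by
    rw [Metric.tendsto_nhds]
    intro ε hε
    obtain ⟨i, hi⟩ := hq.2 w hw (ε/8) (by linarith)
    have hi' : dist (π w) (π (q i)) ≤ ε / 8 :=
      le_of_tendsto (hd w hw _ (hq.1 i)) (hi.mono fun n hn => hn.le)
    have e1 := (hN.comp hφ).tendsto_atTop.eventually hi
    have e2 := hlim.eventually (gt_mem_nhds (show (0:ℝ) < ε / 8 by linarith))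
    have e3 : ∀ᶠ j in atTop, 1 / ((φ j : ℝ) + 1) < ε / 8 :=
      (tendsto_one_div_add_atTop_nhds_zero_nat.comp hφ.tendsto_atTop).eventually
        (gt_mem_nhds (show (0:ℝ) < ε / 8 by linarith))
    filter_upwards [e1, e2, e3, hφ.tendsto_atTop.eventually_ge_atTop i] with j h1 h2 h3 h4
    have h5 := (hN' (φ j)).1 i (Finset.mem_range.2 (by omega))
    simp only [Function.comp] at h1 ⊢
    have h6 := dist_triangle_left (x (φ j) (N (φ j))) (q i (N (φ j))) (w (N (φ j)))
    have h7 : dist (x (φ j) (N (φ j))) (q i (N (φ j))) / r (N (φ j)) ≤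
        dist (w (N (φ j))) (x (φ j) (N (φ j))) / r (N (φ j)) + dist (w (N (φ j))) (q i (N (φ j))) / r (N (φ j)) := by
      rw [← add_div]
      have := hr.1 (N (φ j))
      gcongr
    have h8 := dist_triangle_right (ω (φ j)) (π w) (π (q i))
    have h9 := (abs_lt.1 h5).1
    linarith
  refine ⟨π w, ?_, φ, hφ, hconv⟩
  exact Metric.isClosed_closedBall.mem_of_tendsto hconv (Eventually.of_forall fun n => hω _)

end Main1

section Main2
variable {X : Type u} [MetricSpace X] {p : X} {r : ℕ → ℝ} {F : Set (ℕ → X)}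
  {Ω : Type u} [MetricSpace Ω] {π : (ℕ → X) → Ω}

theorem claimE (hs : HS p) (hP : IsPretangentSpace p r F π)
    {r' : ℕ → ℝ} {F' : Set (ℕ → X)} {Ω' : Type u} [MetricSpace Ω'] {π' : (ℕ → X) → Ω'}
    (hP' : IsPretangentSpace p r' F' π') {ψ : ℕ → ℕ} (hψ : StrictMono ψ) {c : ℝ} (hc : 0 < c)
    (hrr : ∀ n, r' (ψ n) = c * r n) :
    ∃ h : Ω' → Ω, Function.Surjective h ∧ (∀ u v, dist (h u) (h v) = c * dist u v) ∧
      ∀ x' ∈ F', ∀ x ∈ F, (∀ n, x n = x' (ψ n)) → h (π' x') = π x := by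
  obtain ⟨hr, hF, hsur, hd⟩ := hP
  obtain ⟨hr', hF', hsur', hd'⟩ := hP'
  obtain ⟨ht, q, hq⟩ := hs r F hr hF
  obtain ⟨ht', q', hq'⟩ := hs r' F' hr' hF'
  have sc : ∀ (x y : X) n, dist x y / r n = c * (dist x y / r' (ψ n)) := by
    intro x y n
    have := hr.1 n
    rw [hrr]
    field_simp
  obtain ⟨φ, hφ, K, hK, hFK, hzK⟩ := lemB hr.1 hF hq (fun i => q' i ∘ ψ) (fun i => by
    obtain ⟨C, hC⟩ := bdd_of_mem hF' (hq'.1 i)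
    refine ⟨c * C, fun n => ?_⟩
    rw [sc]
    exact mul_le_mul_of_nonneg_left (hC _) hc.le)
  have hF'K : ∀ x' ∈ F', x' ∘ (ψ ∘ φ) ∈ K := by
    intro x' hx'
    refine mem_of_dense (hr.comp hφ).1 hK fun ε hε => ?_
    obtain ⟨i, hi⟩ := hq'.2 x' hx' (ε / c) (by positivity)
    refine ⟨_, hzK i, ?_⟩
    filter_upwards [(hψ.comp hφ).tendsto_atTop.eventually hi] with n hn
    simp only [Function.comp] at hn ⊢
    rw [sc]
    rw [lt_div_iff₀ hc] at hn
    linarith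
  have ex1 : ∀ x' ∈ F', ∃ x ∈ F,
      Tendsto (fun k => dist (x (φ k)) (x' (ψ (φ k))) / r (φ k)) atTop (𝓝 0) :=
    fun x' hx' => ht φ hφ K hK hFK _ (hF'K x' hx')
  have hK' : MaximalSelfStable p (r' ∘ (ψ ∘ φ)) K := by
    have := maximal_scale hc hK
    convert this using 1
    funext n
    exact hrr _
  have ex2 : ∀ x ∈ F, ∃ x' ∈ F',
      Tendsto (fun k => dist (x (φ k)) (x' (ψ (φ k))) / r (φ k)) atTop (𝓝 0) := by
    intro x hx
    obtain ⟨x', hx', h⟩ := ht' _ (hψ.comp hφ) K hK' hF'K _ (hFK x hx)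
    refine ⟨x', hx', ?_⟩
    have := h.const_mul c
    rw [mul_zero] at this
    refine this.congr fun k => ?_
    rw [sc, dist_comm]
    rfl
  have dd : ∀ x' ∈ F', ∀ y' ∈ F', ∀ x ∈ F, ∀ y ∈ F,
      Tendsto (fun k => dist (x (φ k)) (x' (ψ (φ k))) / r (φ k)) atTop (𝓝 0) →
      Tendsto (fun k => dist (y (φ k)) (y' (ψ (φ k))) / r (φ k)) atTop (𝓝 0) →
      dist (π x) (π y) = c * dist (π' x') (π' y') := by
    intro x' hx' y' hy' x hx y hy h1 h2
    have h3 := (hd x hx y hy).comp hφ.tendsto_atTop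
    have h4 := ((hd' x' hx' y' hy').comp (hψ.comp hφ).tendsto_atTop).const_mul c
    have h5 : Tendsto (fun k => dist (x (φ k)) (y (φ k)) / r (φ k)
        - c * (dist (x' (ψ (φ k))) (y' (ψ (φ k))) / r' (ψ (φ k)))) atTop (𝓝 0) := by
      have h6 := h1.add h2
      rw [add_zero] at h6
      refine squeeze_zero_norm (fun k => ?_) h6
      rw [← sc, ← sub_div, ← add_div, Real.norm_eq_abs, abs_div, abs_of_pos (hr.1 _)]
      have := hr.1 (φ k)
      gcongr
      have t1 := dist_triangle4 (x (φ k)) (x' (ψ (φ k))) (y' (ψ (φ k))) (y (φ k))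
      have t2 := dist_triangle4 (x' (ψ (φ k))) (x (φ k)) (y (φ k)) (y' (ψ (φ k)))
      rw [dist_comm (y' (ψ (φ k))) (y (φ k))] at t1
      rw [dist_comm (x' (ψ (φ k))) (x (φ k))] at t2
      rw [abs_le]
      constructor <;> linarith
    have h7 := tendsto_nhds_unique (h3.sub h4) h5
    linarith
  choose s hs1 hs2 using hsur'
  choose t ht1 ht2 using ex1
  have hdist : ∀ x' ∈ F', ∀ x ∈ F,
      Tendsto (fun k => dist (x (φ k)) (x' (ψ (φ k))) / r (φ k)) atTop (𝓝 0) →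
      π (t (s (π' x')) (hs1 _)) = π x := by
    intro x' hx' x hx h
    rw [← dist_eq_zero, dd _ (hs1 (π' x')) x' hx' _ (ht1 _ _) x hx (ht2 _ _) h, hs2]
    simp
  refine ⟨fun u => π (t (s u) (hs1 u)), ?_, ?_, ?_⟩
  · intro ω
    obtain ⟨x, hx, rfl⟩ := hsur ω
    obtain ⟨x', hx', h⟩ := ex2 x hx
    exact ⟨π' x', hdist x' hx' x hx h⟩
  · intro u v
    rw [dd _ (hs1 u) _ (hs1 v) _ (ht1 _ _) _ (ht1 _ _) (ht2 _ _) (ht2 _ _), hs2, hs2]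
  · intro x' hx' x hx h
    refine hdist x' hx' x hx ?_
    simp [h]

/-- interleaving -/
def il {α : Type*} (x y : ℕ → α) (n : ℕ) : α := if n % 2 = 0 then x (n / 2) else y (n / 2)

theorem il_even {α : Type*} (x y : ℕ → α) (n : ℕ) : il x y (2 * n) = x n := by
  simp [il]

theorem il_odd {α : Type*} (x y : ℕ → α) (n : ℕ) : il x y (2 * n + 1) = y n := by
  have : (2 * n + 1) / 2 = n := by omega
  simp [il, this]

theorem il_tendsto {x y : ℕ → ℝ} {L : ℝ} (hx : Tendsto x atTop (𝓝 L)) (hy : Tendsto y atTop (𝓝 L)) :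
    Tendsto (il x y) atTop (𝓝 L) := by
  rw [Metric.tendsto_nhds] at *
  intro ε hε
  obtain ⟨N, hN⟩ := eventually_atTop.1 ((hx ε hε).and (hy ε hε))
  refine eventually_atTop.2 ⟨2 * N, fun n hn => ?_⟩
  have := hN (n / 2) (by omega)
  unfold il
  split_ifs
  exacts [this.1, this.2]

theorem hom_of (hs : HS p) (hP : IsPretangentSpace p r F π) (c : ℝ) (hc : 0 < c) (a a' : Fin 3 → Ω)
    (haa : ∀ i j, dist (a' i) (a' j) = c * dist (a i) (a j))
    (ho : ∀ i, dist (π fun _ => p) (a' i) = c * dist (π fun _ => p) (a i)) :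
    ∃ h : Ω → Ω, Function.Surjective h ∧ (∀ u v, dist (h u) (h v) = c * dist u v) ∧
      h (π fun _ => p) = (π fun _ => p) ∧ ∀ i, h (a i) = a' i := by
  obtain ⟨hr, hF, hsur, hd⟩ := id hP
  choose A hA hAa using fun i => hsur (a i)
  choose A' hA' hAa' using fun i => hsur (a' i)
  let B : Option (Fin 3) → ℕ → X := fun o => o.elim (fun _ => p) A
  let B' : Option (Fin 3) → ℕ → X := fun o => o.elim (fun _ => p) A'
  have hB : ∀ i, B i ∈ F := by rintro (_ | i); exacts [hF.2.1, hA i]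
  have hB' : ∀ i, B' i ∈ F := by rintro (_ | i); exacts [hF.2.1, hA' i]
  have hBB : ∀ i j, dist (π (B' i)) (π (B' j)) = c * dist (π (B i)) (π (B j)) := by
    rintro (_ | i) (_ | j)
    · simp [B, B']
    · simp only [B, B', Option.elim]; rw [hAa, hAa', ho]
    · simp only [B, B', Option.elim]; rw [hAa, hAa', dist_comm, ho, dist_comm]
    · simp only [B, B', Option.elim]; rw [hAa, hAa', hAa, hAa', haa]
  let r' := il r (fun n => c * r n)
  have hr' : IsNormalizingSeq r' := by
    refine ⟨fun n => ?_, il_tendsto hr.2 (by simpa using hr.2.const_mul c)⟩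
    simp only [r', il]
    split_ifs
    exacts [hr.1 _, mul_pos hc (hr.1 _)]
  obtain ⟨F', hF', hsub⟩ := exists_maximal (p := p) (r := r') (G := Set.range fun i => il (B i) (B' i)) (by
    rintro _ ⟨i, rfl⟩ _ ⟨j, rfl⟩
    refine ⟨dist (π (B i)) (π (B j)), ?_⟩
    have h1 := hd _ (hB i) _ (hB j)
    have h2 := (hd _ (hB' i) _ (hB' j)).const_mul c⁻¹
    rw [hBB, inv_mul_cancel_left₀ hc.ne'] at h2
    refine (il_tendsto h1 h2).congr fun n => ?_
    simp only [r', il]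
    split_ifs
    · rfl
    · rw [div_eq_mul_inv, div_eq_mul_inv, mul_inv]; ring) (by
      refine ⟨none, ?_⟩
      funext n
      simp [il, B, B'])
  have hmem : ∀ i, il (B i) (B' i) ∈ F' := fun i => hsub ⟨i, rfl⟩
  obtain ⟨Ω', _, π', hP'⟩ := exists_pretangent hr' hF'
  obtain ⟨h1, s1, d1, f1⟩ := claimE hs hP hP' (ψ := fun n => 2 * n) (fun a b h => by simp only; omega)
    one_pos (fun n => by simp only [r', il_even, one_mul])
  obtain ⟨h2, s2, d2, f2⟩ := claimE hs hP hP' (ψ := fun n => 2 * n + 1) (fun a b h => by simp only; omega)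
    hc (fun n => by simp only [r', il_odd])
  have i1 : Function.Injective h1 := fun u v h => by
    rw [← dist_eq_zero]
    have := d1 u v
    rw [h, dist_self] at this
    linarith
  let g := Function.surjInv s1
  have hg : ∀ u, h1 (g u) = u := Function.surjInv_eq s1
  have hg' : ∀ u, g (h1 u) = u := fun u => i1 (hg _)
  have fB : ∀ i, h2 (g (π (B i))) = π (B' i) := by
    intro i
    rw [← f1 _ (hmem i) _ (hB i) (fun n => (il_even _ _ _).symm), hg']
    exact f2 _ (hmem i) _ (hB' i) (fun n => (il_odd _ _ _).symm)
  refine ⟨fun u => h2 (g u), fun t => ?_, fun u v => ?_, fB none, fun i => ?_⟩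
  · obtain ⟨s, rfl⟩ := s2 t
    exact ⟨h1 s, by simp only [hg']⟩
  · have := d1 (g u) (g v)
    rw [hg, hg, one_mul] at this
    simp only [d2, this]
  · have := fB (some i)
    simp only [B, B', Option.elim, hAa, hAa'] at this
    exact this

theorem good_of (hs : HS p) (hP : IsPretangentSpace p r F π) (hm : MidpointConvexAt p)
    (hA : ∀ ε : ℝ, 0 < ε → ∀ᶠ q : X × X × X × X in 𝓝 (p, p, p, p),
      -ε ≤ A3 p q.1 q.2.1 q.2.2.1 q.2.2.2) : Good Ω (π fun _ => p) :=
  ⟨proper_of hs hP, ptol_of hP hA, mid_of hs hP hm, hom_of hs hP⟩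

end Main2

section Main3
variable {X : Type u} [MetricSpace X] {p : X}

theorem sublimit (hI : ∀ (r : ℕ → ℝ) (F : Set (ℕ → X)) (Ω : Type u) [MetricSpace Ω]
        (π : (ℕ → X) → Ω), IsPretangentSpace p r F π →
        Ptolemaic Ω ∧ IsGeodesicSpace Ω ∧ BusemannConvex Ω) {r : ℕ → ℝ} (hr : IsNormalizingSeq r)
    {ι : Type*} [Countable ι] (z : ι → ℕ → X) (hz : ∀ i, Bdd p r (z i)) :
    ∃ φ : ℕ → ℕ, StrictMono φ ∧ ∃ (Ω : Type u) (_ : MetricSpace Ω) (ω : ι → Ω),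
      Ptolemaic Ω ∧ IsGeodesicSpace Ω ∧
      (∀ i j, Tendsto (fun n => dist (z i (φ n)) (z j (φ n)) / r (φ n)) atTop (𝓝 (dist (ω i) (ω j)))) ∧
      ∀ a : Ω, ∃ w : ℕ → X, ∀ i, Tendsto (fun n => dist (z i (φ n)) (w n) / r (φ n)) atTop
        (𝓝 (dist (ω i) a)) := by
  obtain ⟨φ, hφ, F, hF, h⟩ := exists_subseq_maximal (p := p) hr.1 z hz
  obtain ⟨Ω, inst, π, hP⟩ := exists_pretangent (hr.comp hφ) hF
  obtain ⟨h1, h2, _⟩ := hI _ F Ω π hP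
  refine ⟨φ, hφ, Ω, inst, fun i => π (z i ∘ φ), h1, h2, fun i j => hP.2.2.2 _ (h i) _ (h j), fun a => ?_⟩
  obtain ⟨w, hw, rfl⟩ := hP.2.2.1 a
  exact ⟨w, fun i => hP.2.2.2 _ (h i) _ hw⟩

theorem bdd_one {r : ℕ → ℝ} (hr : ∀ n, 0 < r n) {x : ℕ → X} {C : ℝ} (h : ∀ n, dist (x n) p ≤ C * r n) :
    Bdd p r x := ⟨C, fun n => (div_le_iff₀ (hr n)).2 (h n)⟩

theorem A3_of (hI : ∀ (r : ℕ → ℝ) (F : Set (ℕ → X)) (Ω : Type u) [MetricSpace Ω]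
        (π : (ℕ → X) → Ω), IsPretangentSpace p r F π →
        Ptolemaic Ω ∧ IsGeodesicSpace Ω ∧ BusemannConvex Ω) (ε : ℝ) (hε : 0 < ε) :
    ∀ᶠ q : X × X × X × X in 𝓝 (p, p, p, p), -ε ≤ A3 p q.1 q.2.1 q.2.2.1 q.2.2.2 := by
  by_contra hc
  obtain ⟨q, hq, hlt⟩ := exists_seq_forall_of_frequently (not_eventually.1 hc)
  have hr : IsNormalizingSeq (fun n => delta4 p (q n).1 (q n).2.1 (q n).2.2.1 (q n).2.2.2) := by
    refine ⟨fun n => ?_, ?_⟩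
    · apply delta4_pos
      intro h
      apply hlt n
      rw [A3, if_pos h]
      linarith
    · have hc : Continuous fun q : X × X × X × X => delta4 p q.1 q.2.1 q.2.2.1 q.2.2.2 := by
        unfold delta4; fun_prop
      have := (hc.tendsto (p, p, p, p)).comp hq
      simpa [delta4, Function.comp_def] using this
  obtain ⟨φ, hφ, Ω, _, ω, hpt, _, hl, _⟩ := sublimit hI hr
    (fun i : Fin 4 => ![fun n => (q n).1, fun n => (q n).2.1, fun n => (q n).2.2.1, fun n => (q n).2.2.2] i) (by
      intro i
      fin_cases i
      · exact bdd_one hr.1 (C := 1) fun n => by rw [one_mul]; exact (delta4_bounds _ _ _ _).1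
      · exact bdd_one hr.1 (C := 1) fun n => by rw [one_mul]; exact (delta4_bounds _ _ _ _).2.1
      · exact bdd_one hr.1 (C := 1) fun n => by rw [one_mul]; exact (delta4_bounds _ _ _ _).2.2.1
      · exact bdd_one hr.1 (C := 1) fun n => by rw [one_mul]; exact (delta4_bounds _ _ _ _).2.2.2)
  have key : dist (ω 1) (ω 0) * dist (ω 2) (ω 3) + dist (ω 1) (ω 3) * dist (ω 2) (ω 0) + ε ≤
      dist (ω 1) (ω 2) * dist (ω 0) (ω 3) := by
    refine le_of_tendsto_of_tendsto' ((((hl 1 0).mul (hl 2 3)).add ((hl 1 3).mul (hl 2 0))).add_const ε)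
      ((hl 1 2).mul (hl 0 3)) fun n => ?_
    have h := hlt (φ n)
    rw [A3_ge hε.le] at h
    push Not at h
    have hrn := hr.1 (φ n)
    have e : ∀ a b R : ℝ, a / R * (b / R) = a * b / R ^ 2 := by intro a b R; ring
    rw [e, e, e, ← add_div, div_add' _ _ _ (by positivity)]
    gcongr
    exact h.le
  have := hpt (ω 1) (ω 2) (ω 0) (ω 3)
  linarith

theorem mid_of_geod {Ω : Type u} [MetricSpace Ω] (h : IsGeodesicSpace Ω) (a b : Ω) :
    ∃ m, dist a m = dist a b / 2 ∧ dist b m = dist a b / 2 := by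
  obtain ⟨_, f, hf, _, h0, h1⟩ := h a b
  have hd := dist_nonneg (x := a) (y := b)
  have m0 : (0:ℝ) ∈ Set.Icc 0 (dist a b) := ⟨le_rfl, hd⟩
  have m1 : dist a b ∈ Set.Icc 0 (dist a b) := ⟨hd, le_rfl⟩
  have m2 : dist a b / 2 ∈ Set.Icc 0 (dist a b) := ⟨by linarith, by linarith⟩
  refine ⟨f (dist a b / 2), ?_, ?_⟩
  · have := hf _ m0 _ m2
    rw [h0] at this
    rw [this, zero_sub, abs_neg, abs_of_nonneg m2.1]
  · have := hf _ m1 _ m2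
    rw [h1] at this
    rw [this, abs_of_nonneg (by linarith)]; ring

theorem midConv_of (hI : ∀ (r : ℕ → ℝ) (F : Set (ℕ → X)) (Ω : Type u) [MetricSpace Ω]
        (π : (ℕ → X) → Ω), IsPretangentSpace p r F π →
        Ptolemaic Ω ∧ IsGeodesicSpace Ω ∧ BusemannConvex Ω) : MidpointConvexAt p := by
  intro x y hx hy
  let D : ℕ → ℝ := fun n => max (dist (x n) p) (dist (y n) p)
  let J : ℕ → X → ℝ := fun n z => max |dist (x n) z - dist (x n) (y n) / 2| |dist (y n) z - dist (x n) (y n) / 2|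
  have hJ0 : ∀ n z, 0 ≤ J n z := fun n z => le_max_of_le_left (abs_nonneg _)
  have hD0 : ∀ n, 0 ≤ D n := fun n => le_max_of_le_left dist_nonneg
  have hDz : ∀ n, D n = 0 → J n p = 0 := by
    intro n h
    have h1 : dist (x n) p ≤ 0 := (le_max_left _ _).trans h.le
    have h2 : dist (y n) p ≤ 0 := (le_max_right _ _).trans h.le
    have e1 := dist_le_zero.1 h1
    have e2 := dist_le_zero.1 h2
    simp [J, e1, e2]
  have claim : ∀ ε : ℝ, 0 < ε → ∀ᶠ n in atTop, ∃ z, J n z ≤ ε * D n := by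
    intro ε hε
    by_contra hc
    obtain ⟨ψ, hψ, h⟩ := extraction_of_frequently_atTop (not_eventually.1 hc)
    push Not at h
    have hr : IsNormalizingSeq (D ∘ ψ) := by
      refine ⟨fun n => lt_of_le_of_ne (hD0 _) fun e => ?_, ?_⟩
      · have := h n p
        have e' : D (ψ n) = 0 := e.symm
        rw [hDz _ e', e', mul_zero] at this
        exact lt_irrefl _ this
      · have h1 := (tendsto_iff_dist_tendsto_zero.1 hx).max (tendsto_iff_dist_tendsto_zero.1 hy)
        rw [max_self] at h1
        exact h1.comp hψ.tendsto_atTop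
    obtain ⟨φ, hφ, Ω, _, ω, _, hg, hl, hw⟩ := sublimit hI hr
      (fun i : Fin 2 => ![x ∘ ψ, y ∘ ψ] i) (by
      intro i
      fin_cases i
      · exact bdd_one hr.1 (C := 1) fun n => by rw [one_mul]; exact le_max_left _ _
      · exact bdd_one hr.1 (C := 1) fun n => by rw [one_mul]; exact le_max_right _ _)
    obtain ⟨m, hm1, hm2⟩ := mid_of_geod hg (ω 0) (ω 1)
    obtain ⟨w, hw⟩ := hw m
    have l1 := ((hw 0).sub ((hl 0 1).div_const 2)).abs
    have l2 := ((hw 1).sub ((hl 0 1).div_const 2)).abs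
    rw [hm1, sub_self, abs_zero] at l1
    rw [hm2, sub_self, abs_zero] at l2
    obtain ⟨n, h1, h2⟩ := ((l1.eventually (gt_mem_nhds hε)).and (l2.eventually (gt_mem_nhds hε))).exists
    have h3 := h (φ n) (w n)
    have hrn := hr.1 (φ n)
    rw [div_right_comm, ← sub_div, abs_div, abs_of_pos hrn, div_lt_iff₀ hrn] at h1 h2
    exact absurd (max_le h1.le h2.le) (not_le.2 h3)
  have near : ∀ n, ∃ z, J n z ≤ (⨅ z, J n z) + D n / ((n:ℝ) + 1) := by
    intro n
    have : Nonempty X := ⟨p⟩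
    rcases (hD0 n).eq_or_lt with h | h
    · refine ⟨p, ?_⟩
      rw [hDz n h.symm, ← h]
      simpa using Real.iInf_nonneg (hJ0 n)
    · obtain ⟨z, hz⟩ := exists_lt_of_ciInf_lt (show (⨅ z, J n z) < (⨅ z, J n z) + D n / ((n:ℝ) + 1) by
        have : 0 < D n / ((n:ℝ) + 1) := by positivity
        linarith)
      exact ⟨z, hz.le⟩
  choose z hz using near
  refine ⟨z, infmid_iff.2 fun ε hε => ?_⟩
  have e3 : ∀ᶠ n : ℕ in atTop, 1 / ((n : ℝ) + 1) < ε / 2 :=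
    tendsto_one_div_add_atTop_nhds_zero_nat.eventually (gt_mem_nhds (show (0:ℝ) < ε / 2 by linarith))
  filter_upwards [claim (ε/2) (by linarith), e3] with n ⟨w, hw⟩ h3
  have h1 : (⨅ z, J n z) ≤ J n w := ciInf_le ⟨0, by rintro _ ⟨v, rfl⟩; exact hJ0 n v⟩ w
  have h2 : D n / ((n:ℝ) + 1) ≤ ε / 2 * D n := by
    rw [div_eq_mul_one_div, mul_comm]
    exact mul_le_mul_of_nonneg_right h3.le (hD0 n)
  have h4 : J n (z n) ≤ ε * D n := by linarith [hz n]
  exact ⟨(le_max_left _ _).trans h4, (le_max_right _ _).trans h4⟩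

theorem busAt_of (hI : ∀ (r : ℕ → ℝ) (F : Set (ℕ → X)) (Ω : Type u) [MetricSpace Ω]
        (π : (ℕ → X) → Ω), IsPretangentSpace p r F π →
        Ptolemaic Ω ∧ IsGeodesicSpace Ω ∧ BusemannConvex Ω) : BusemannConvexAt p := by
  refine ⟨midConv_of hI, fun x0 x1 y m hx0 hx1 hy hm => ?_⟩
  rw [infmid_iff] at hm
  let D : ℕ → ℝ := fun n => delta3 p (x0 n) (y n) (x1 n)
  have b0 : ∀ n, dist (x0 n) p ≤ D n := fun n => le_max_left _ _
  have by' : ∀ n, dist (y n) p ≤ D n := fun n => le_max_of_le_right (le_max_left _ _)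
  have b1 : ∀ n, dist (x1 n) p ≤ D n := fun n => le_max_of_le_right (le_max_right _ _)
  have hD0 : ∀ n, 0 ≤ D n := fun n => dist_nonneg.trans (b0 n)
  by_contra hc
  rw [Metric.tendsto_nhds] at hc
  push Not at hc
  obtain ⟨ε, hε, hfr⟩ := hc
  have hm1 := hm 1 one_pos
  obtain ⟨ψ, hψ, h'⟩ := extraction_of_frequently_atTop (hfr.and_eventually hm1)
  have hfacts : ∀ n, 0 < D (ψ n) ∧ (dist (x0 (ψ n)) (y (ψ n)) + dist (x1 (ψ n)) (y (ψ n))) / 2 + ε * D (ψ n)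
      ≤ dist (m (ψ n)) (y (ψ n)) := by
    intro n
    have h := (h' n).1
    rw [Real.dist_eq, sub_zero] at h
    have hpos : 0 < D (ψ n) := by
      rcases (hD0 (ψ n)).eq_or_lt with e | e
      · exfalso
        have e' : delta3 p (x0 (ψ n)) (y (ψ n)) (x1 (ψ n)) = 0 := e.symm
        rw [e', div_zero, abs_zero] at h
        linarith
      · exact e
    refine ⟨hpos, ?_⟩
    have hpos' : 0 < delta3 p (x0 (ψ n)) (y (ψ n)) (x1 (ψ n)) := hpos
    rw [abs_of_nonneg (div_nonneg (le_max_right _ _) hpos'.le), le_div_iff₀ hpos'] at h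
    have h2 : 0 < ε * delta3 p (x0 (ψ n)) (y (ψ n)) (x1 (ψ n)) := by positivity
    rcases le_max_iff.1 h with h | h
    · change _ + ε * delta3 p (x0 (ψ n)) (y (ψ n)) (x1 (ψ n)) ≤ _
      linarith
    · linarith
  have hr : IsNormalizingSeq (D ∘ ψ) := by
    refine ⟨fun n => (hfacts n).1, ?_⟩
    have h1 := (tendsto_iff_dist_tendsto_zero.1 hx0).max
      ((tendsto_iff_dist_tendsto_zero.1 hy).max (tendsto_iff_dist_tendsto_zero.1 hx1))
    rw [max_self, max_self] at h1
    exact h1.comp hψ.tendsto_atTop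
  obtain ⟨φ, hφ, Ω, _, ω, hpt, _, hl, _⟩ := sublimit hI hr
    (fun i : Fin 4 => ![x0 ∘ ψ, x1 ∘ ψ, y ∘ ψ, m ∘ ψ] i) (by
      intro i
      fin_cases i
      · exact bdd_one hr.1 (C := 1) fun n => by rw [one_mul]; exact b0 _
      · exact bdd_one hr.1 (C := 1) fun n => by rw [one_mul]; exact b1 _
      · exact bdd_one hr.1 (C := 1) fun n => by rw [one_mul]; exact by' _
      · refine bdd_one hr.1 (C := 3) fun n => ?_
        have h1 := (abs_le.1 (h' n).2.1).2
        have h2 := dist_triangle_left (m (ψ n)) p (x0 (ψ n))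
        have h3 := dist_triangle_right (x0 (ψ n)) (x1 (ψ n)) p
        have h4 : max (dist (x0 (ψ n)) p) (dist (x1 (ψ n)) p) ≤ D (ψ n) := max_le (b0 _) (b1 _)
        have h5 := b0 (ψ n)
        have h6 := b1 (ψ n)
        change dist (m (ψ n)) p ≤ 3 * D (ψ n)
        linarith)
  have mid : ∀ e > 0, |dist (ω 0) (ω 3) - dist (ω 0) (ω 1) / 2| ≤ e ∧
      |dist (ω 1) (ω 3) - dist (ω 0) (ω 1) / 2| ≤ e := by
    intro e he
    have ev := (hψ.comp hφ).tendsto_atTop.eventually (hm e he)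
    constructor
    · refine le_of_tendsto ((hl 0 3).sub ((hl 0 1).div_const 2)).abs ?_
      filter_upwards [ev] with n hn
      have hrn := hr.1 (φ n)
      rw [div_right_comm, ← sub_div, abs_div, abs_of_pos hrn, div_le_iff₀ hrn]
      exact hn.1.trans (mul_le_mul_of_nonneg_left (max_le (b0 _) (b1 _)) he.le)
    · refine le_of_tendsto ((hl 1 3).sub ((hl 0 1).div_const 2)).abs ?_
      filter_upwards [ev] with n hn
      have hrn := hr.1 (φ n)
      rw [div_right_comm, ← sub_div, abs_div, abs_of_pos hrn, div_le_iff₀ hrn]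
      exact hn.2.trans (mul_le_mul_of_nonneg_left (max_le (b0 _) (b1 _)) he.le)
  have m0 : dist (ω 0) (ω 3) = dist (ω 0) (ω 1) / 2 := by
    have := le_of_forall_pos_le_add (a := |dist (ω 0) (ω 3) - dist (ω 0) (ω 1) / 2|) (b := 0)
      fun e he => by rw [zero_add]; exact (mid e he).1
    linarith [abs_nonpos_iff.1 this]
  have m1 : dist (ω 1) (ω 3) = dist (ω 0) (ω 1) / 2 := by
    have := le_of_forall_pos_le_add (a := |dist (ω 1) (ω 3) - dist (ω 0) (ω 1) / 2|) (b := 0)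
      fun e he => by rw [zero_add]; exact (mid e he).2
    linarith [abs_nonpos_iff.1 this]
  have low : (dist (ω 0) (ω 2) + dist (ω 1) (ω 2)) / 2 + ε ≤ dist (ω 3) (ω 2) := by
    refine le_of_tendsto_of_tendsto' ((((hl 0 2).add (hl 1 2)).div_const 2).add_const ε) (hl 3 2) fun n => ?_
    have hrn := hr.1 (φ n)
    rw [← add_div, div_right_comm, div_add' _ _ _ hrn.ne']
    exact div_le_div_of_nonneg_right (hfacts (φ n)).2 hrn.le
  rcases (dist_nonneg (x := ω 0) (y := ω 1)).eq_or_lt with h | h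
  · rw [← h] at m0 m1
    have e0 : ω 0 = ω 3 := by rw [← dist_eq_zero, m0]; simp
    have e1 : ω 1 = ω 3 := by rw [← dist_eq_zero, m1]; simp
    rw [e0, e1] at low
    linarith
  · have k := ptol_between hpt (ω 0) (ω 1) (ω 3) (ω 2)
    rw [dist_comm (ω 3) (ω 1), m0, m1] at k
    have k2 : dist (ω 3) (ω 2) * dist (ω 0) (ω 1) ≤
        ((dist (ω 0) (ω 2) + dist (ω 1) (ω 2)) / 2) * dist (ω 0) (ω 1) := by linarith
    have := le_of_mul_le_mul_right k2 h
    linarith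

end Main3

/-- if every pretangent space is separable and tangent, then
every pretangent space is a Ptolemaic, Busemann convex geodesic metric space
(CAT(0)) iff `X` is Busemann convex at `p` and `liminf A₃ ≥ 0`. -/
theorem pretangent_CAT0_iff_busemannConvexAt_and_liminf_A3
    {X : Type u} [MetricSpace X] (p : X)
    (hst : ∀ (r : ℕ → ℝ) (F : Set (ℕ → X)) (Ω : Type u) [MetricSpace Ω]
      (π : (ℕ → X) → Ω), IsPretangentSpace p r F π →
      TopologicalSpace.SeparableSpace Ω ∧ IsTangentFamily p r F) :
    (∀ (r : ℕ → ℝ) (F : Set (ℕ → X)) (Ω : Type u) [MetricSpace Ω]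
        (π : (ℕ → X) → Ω), IsPretangentSpace p r F π →
        Ptolemaic Ω ∧ IsGeodesicSpace Ω ∧ BusemannConvex Ω) ↔
      (BusemannConvexAt p ∧
        0 ≤ liminf (fun q : X × X × X × X => A3 p q.1 q.2.1 q.2.2.1 q.2.2.2)
            (𝓝 (p, p, p, p))) := by
  have hs := HS_of hst
  constructor
  · intro hI
    exact ⟨busAt_of hI, liminf_A3_iff.2 fun ε hε => A3_of hI ε hε⟩
  · rintro ⟨hB, hA⟩ r F Ω _ π hP
    have H := good_of hs hP hB.1 (liminf_A3_iff.1 hA)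
    exact ⟨H.ptol, H.geodesic, H.busemann⟩
end

section
/- Let (X,d) be a metric space possessing the doubling property. Then for every point p ∈ X, every pretangent space Ω_{p,r̃}^X to X at p is separable. -/
open Filter Topology

universe u

/-- A metric space has the doubling property if there is `C ≥ 1` such that any
set of finite diameter can be covered by at most `C` sets of at most half its
diameter. -/
def DoublingProperty (X : Type u) [MetricSpace X] : Prop :=
  ∃ C : ℕ, 1 ≤ C ∧ ∀ A : Set X, EMetric.diam A ≠ ⊤ →
    ∃ B : Finset (Set X), B.card ≤ C ∧ (A ⊆ ⋃ s ∈ B, s) ∧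
      ∀ s ∈ B, EMetric.diam s ≤ EMetric.diam A / 2

/-- Real-valued form of the doubling property. -/
lemma doubling_real {X : Type u} [MetricSpace X] (h : DoublingProperty X) :
    ∃ C : ℕ, ∀ (D : ℝ), 0 ≤ D → ∀ A : Set X, (∀ x ∈ A, ∀ y ∈ A, dist x y ≤ D) →
      ∃ B : Finset (Set X), B.card ≤ C ∧ (A ⊆ ⋃ s ∈ B, s) ∧
        ∀ s ∈ B, ∀ x ∈ s, ∀ y ∈ s, dist x y ≤ D / 2 := by
  obtain ⟨C, -, hC⟩ := h
  refine ⟨C, fun D hD A hA => ?_⟩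
  have hdiam : Metric.ediam A ≤ ENNReal.ofReal D :=
    Metric.ediam_le_of_forall_dist_le hA
  obtain ⟨B, hB, hAB, hs⟩ := hC A (ne_top_of_le_ne_top ENNReal.ofReal_ne_top hdiam)
  refine ⟨B, hB, hAB, fun s hsB x hx y hy => ?_⟩
  have h1 : edist x y ≤ ENNReal.ofReal (D / 2) := by
    refine (Metric.edist_le_ediam_of_mem hx hy).trans ((hs s hsB).trans ?_)
    rw [ENNReal.ofReal_div_of_pos (by norm_num)]
    rw [ENNReal.ofReal_ofNat]
    exact ENNReal.div_le_div_right hdiam 2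
  rw [edist_dist] at h1
  exact (ENNReal.ofReal_le_ofReal_iff (by positivity)).1 h1

lemma doubling_iter {X : Type u} [MetricSpace X] (h : DoublingProperty X) :
    ∃ C : ℕ, ∀ (k : ℕ) (D : ℝ), 0 ≤ D → ∀ A : Set X, (∀ x ∈ A, ∀ y ∈ A, dist x y ≤ D) →
      ∃ B : Finset (Set X), B.card ≤ C ^ k ∧ (A ⊆ ⋃ s ∈ B, s) ∧
        ∀ s ∈ B, ∀ x ∈ s, ∀ y ∈ s, dist x y ≤ D / 2 ^ k := by
  classical
  obtain ⟨C, hC⟩ := doubling_real h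
  refine ⟨C, fun k => ?_⟩
  induction k with
  | zero =>
    intro D hD A hA
    exact ⟨{A}, by simp, by simp, by simpa using hA⟩
  | succ k ih =>
    intro D hD A hA
    obtain ⟨B, hB, hAB, hd⟩ := ih D hD A hA
    have key : ∀ s : Set X, ∃ B' : Finset (Set X), s ∈ B → B'.card ≤ C ∧ (s ⊆ ⋃ t ∈ B', t) ∧
        ∀ t ∈ B', ∀ x ∈ t, ∀ y ∈ t, dist x y ≤ D / 2 ^ k / 2 := by
      intro s
      by_cases hs : s ∈ B
      · obtain ⟨B', hB'⟩ := hC (D / 2 ^ k) (by positivity) s (hd s hs)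
        exact ⟨B', fun _ => hB'⟩
      · exact ⟨∅, fun h => absurd h hs⟩
    choose f hf using key
    refine ⟨B.biUnion f, ?_, ?_, ?_⟩
    · refine (Finset.card_biUnion_le_card_mul B f C fun s hs => (hf s hs).1).trans ?_
      rw [pow_succ]
      exact Nat.mul_le_mul_right C hB
    · intro x hx
      obtain ⟨s, hs, hxs⟩ := Set.mem_iUnion₂.1 (hAB hx)
      obtain ⟨t, ht, hxt⟩ := Set.mem_iUnion₂.1 ((hf s hs).2.1 hxs)
      exact Set.mem_iUnion₂.2 ⟨t, Finset.mem_biUnion.2 ⟨s, hs, ht⟩, hxt⟩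
    · intro t ht x hx y hy
      obtain ⟨s, hs, ht⟩ := Finset.mem_biUnion.1 ht
      have := (hf s hs).2.2 t ht x hx y hy
      rwa [div_div, ← pow_succ] at this

/-- Separated subsets of balls of a pretangent space are finite. -/
lemma pretangent_finite {X : Type u} [MetricSpace X] (h : DoublingProperty X)
    (p : X) (r : ℕ → ℝ) (F : Set (ℕ → X)) (Ω : Type u) [MetricSpace Ω]
    (π : (ℕ → X) → Ω) (hΩ : IsPretangentSpace p r F π) (ε R : ℝ) (hε : 0 < ε) (hR : 0 < R)
    (S : Set Ω) (hS : ∀ x ∈ S, ∀ y ∈ S, x ≠ y → ε < dist x y)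
    (hSR : ∀ x ∈ S, dist x (π fun _ => p) < R) : S.Finite := by
  classical
  obtain ⟨⟨hr, -⟩, ⟨-, hp, -⟩, hsurj, hlim⟩ := hΩ
  obtain ⟨C, hC⟩ := doubling_iter h
  obtain ⟨k, hk⟩ := exists_nat_gt (2 * R / ε)
  have hk2 : 2 * R / 2 ^ k ≤ ε := by
    have h1 : (k : ℝ) < 2 ^ k := by exact_mod_cast Nat.lt_two_pow_self
    rw [div_lt_iff₀ hε] at hk
    rw [div_le_iff₀ (by positivity)]
    nlinarith
  by_contra hinf
  obtain ⟨T, hTS, hT⟩ := Set.Infinite.exists_subset_card_eq hinf (C ^ k + 1)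
  choose x hxF hx using hsurj
  have ev1 : ∀ᶠ n in atTop, ∀ a ∈ T, dist (x a n) p / r n < R := by
    rw [Filter.eventually_all_finset]
    intro a ha
    have := hlim (x a) (hxF a) _ hp
    rw [hx] at this
    exact this.eventually (gt_mem_nhds (hSR a (hTS ha)))
  have ev2 : ∀ᶠ n in atTop, ∀ a ∈ T, ∀ b ∈ T, a ≠ b → ε < dist (x a n) (x b n) / r n := by
    rw [Filter.eventually_all_finset]
    intro a ha
    rw [Filter.eventually_all_finset]
    intro b hb
    rw [Filter.eventually_imp_distrib_left]
    intro hab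
    have := hlim (x a) (hxF a) (x b) (hxF b)
    rw [hx, hx] at this
    exact this.eventually (lt_mem_nhds (hS a (hTS ha) b (hTS hb) hab))
  obtain ⟨n, h1, h2⟩ := (ev1.and ev2).exists
  have hrn := hr n
  obtain ⟨B, hB, hAB, hd⟩ := hC k (2 * R * r n) (by positivity) ((fun a => x a n) '' (T : Set Ω)) (by
    rintro _ ⟨a, ha, rfl⟩ _ ⟨b, hb, rfl⟩
    have ha' := h1 a ha
    have hb' := h1 b hb
    rw [div_lt_iff₀ hrn] at ha' hb'
    have := dist_triangle_right (x a n) (x b n) p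
    show dist (x a n) (x b n) ≤ _
    linarith)
  have key : ∀ a : Ω, ∃ s : Set X, a ∈ T → s ∈ B ∧ x a n ∈ s := by
    intro a
    by_cases ha : a ∈ T
    · obtain ⟨s, hs, hxs⟩ := Set.mem_iUnion₂.1 (hAB ⟨a, ha, rfl⟩)
      exact ⟨s, fun _ => ⟨hs, hxs⟩⟩
    · exact ⟨∅, fun h => absurd h ha⟩
  choose f hf using key
  obtain ⟨a, ha, b, hb, hab, hfab⟩ := Finset.exists_ne_map_eq_of_card_lt_of_maps_to
    (s := T) (t := B) (f := f) (by omega) (fun a ha => (hf a ha).1)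
  have h3 := h2 a ha b hb hab
  have h4 := hd (f a) (hf a ha).1 _ (hf a ha).2 (x b n) (by rw [hfab]; exact (hf b hb).2)
  rw [lt_div_iff₀ hrn] at h3
  have h5 : 2 * R * r n / 2 ^ k = 2 * R / 2 ^ k * r n := by ring
  rw [h5] at h4
  have := mul_le_mul_of_nonneg_right hk2 hrn.le
  linarith

lemma exists_maximal_sep (Ω : Type u) [MetricSpace Ω] (ε : ℝ) (hε : 0 < ε) :
    ∃ S : Set Ω, (∀ x ∈ S, ∀ y ∈ S, x ≠ y → ε < dist x y) ∧ ∀ x, ∃ y ∈ S, dist x y ≤ ε := by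
  obtain ⟨S, hS⟩ := zorn_subset {S : Set Ω | ∀ x ∈ S, ∀ y ∈ S, x ≠ y → ε < dist x y} (by
    intro c hc hchain
    refine ⟨⋃₀ c, ?_, fun s hs => Set.subset_sUnion_of_mem hs⟩
    rintro x ⟨s, hs, hxs⟩ y ⟨t, ht, hyt⟩ hxy
    rcases hchain.total hs ht with hst | hst
    · exact hc ht x (hst hxs) y hyt hxy
    · exact hc hs x hxs y (hst hyt) hxy)
  refine ⟨S, hS.prop, fun x => ?_⟩
  by_contra! hx
  have hmem : insert x S ∈ {S : Set Ω | ∀ x ∈ S, ∀ y ∈ S, x ≠ y → ε < dist x y} := by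
    rintro a (rfl | ha) b (rfl | hb) hab
    · exact absurd rfl hab
    · exact hx b hb
    · rw [dist_comm]; exact hx a ha
    · exact hS.prop a ha b hb hab
  have hxS : x ∈ S := hS.le_of_ge hmem (Set.subset_insert x S) (Set.mem_insert x S)
  have := hx x hxS
  rw [dist_self] at this
  linarith

/-- if `X` has the doubling property, then every pretangent
space to `X` at any point `p` is separable. -/
theorem pretangent_separable_of_doubling
    {X : Type u} [MetricSpace X] (h : DoublingProperty X) :
    ∀ (p : X) (r : ℕ → ℝ) (F : Set (ℕ → X)) (Ω : Type u) [MetricSpace Ω]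
      (π : (ℕ → X) → Ω), IsPretangentSpace p r F π →
      TopologicalSpace.SeparableSpace Ω := by
  intro p r F Ω _ π hΩ
  have : SecondCountableTopology Ω := by
    refine Metric.secondCountable_of_almost_dense_set fun ε hε => ?_
    obtain ⟨S, hS, hcov⟩ := exists_maximal_sep Ω ε hε
    refine ⟨S, ?_, hcov⟩
    have hU : S ⊆ ⋃ m : ℕ, {x ∈ S | dist x (π fun _ => p) < (m : ℝ) + 1} := by
      intro x hx
      obtain ⟨m, hm⟩ := exists_nat_gt (dist x (π fun _ => p))
      exact Set.mem_iUnion.2 ⟨m, hx, by linarith⟩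
    refine (Set.countable_iUnion fun m => ?_).mono hU
    exact (pretangent_finite h p r F Ω π hΩ ε (m + 1) hε (by positivity) _
      (fun x hx y hy hxy => hS x hx.1 y hy.1 hxy) (fun x hx => hx.2)).countable
  infer_instance
end

section
/- Let X be a subset of a finite-dimensional real normed vector space, equipped with the induced metric. Then for every point p ∈ X, every pretangent space Ω_{p,r̃}^X to X at p is separable. -/
open Filter Topology

universe u

/-- if `X` is a subset of a finite-dimensional real normed
vector space (with the induced metric), then every pretangent space to `X` at
any point `p` is separable. -/
theorem pretangent_separable_of_subset_findim
    {E : Type u} [NormedAddCommGroup E] [NormedSpace ℝ E]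
    [FiniteDimensional ℝ E] (X : Set E) :
    ∀ (p : X) (r : ℕ → ℝ) (F : Set (ℕ → X)) (Ω : Type u) [MetricSpace Ω]
      (π : (ℕ → X) → Ω), IsPretangentSpace p r F π →
      TopologicalSpace.SeparableSpace Ω := by
  intro p r F Ω _ π h
  obtain ⟨⟨hr, -⟩, ⟨-, hp, -⟩, hsurj, hlim⟩ := h
  have : ProperSpace E := FiniteDimensional.proper ℝ E
  have hU : ((hyperfilter ℕ : Ultrafilter ℕ) : Filter ℕ) ≤ atTop := by
    rw [← Nat.cofinite_eq_atTop]
    exact hyperfilter_le_cofinite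
  have key : ∀ x ∈ F, ∃ e : E,
      Tendsto (fun n => (r n)⁻¹ • ((x n : E) - (p : E))) (hyperfilter ℕ : Ultrafilter ℕ) (𝓝 e) := by
    intro x hx
    have h1 := hlim x hx _ hp
    have h2 : ∀ᶠ n in atTop, (r n)⁻¹ • ((x n : E) - (p : E)) ∈
        Metric.closedBall (0 : E) (dist (π x) (π fun _ => p) + 1) := by
      filter_upwards [h1.eventually (gt_mem_nhds (lt_add_one _))] with n hn
      rw [mem_closedBall_zero_iff, norm_smul, norm_inv, Real.norm_of_nonneg (hr n).le,
        ← dist_eq_norm, inv_mul_eq_div]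
      exact hn.le
    obtain ⟨e, -, he⟩ := (isCompact_closedBall (0 : E) _).ultrafilter_le_nhds
      ((hyperfilter ℕ).map (fun n => (r n)⁻¹ • ((x n : E) - (p : E))))
      (le_principal_iff.2 (hU h2))
    exact ⟨e, he⟩
  choose s hsF hs using hsurj
  choose f hf using fun ω => key (s ω) (hsF ω)
  have hiso : Isometry f := by
    refine Isometry.of_dist_eq fun a b => ?_
    have h1 := (hf a).dist (hf b)
    have h2 := (hlim _ (hsF a) _ (hsF b)).mono_left hU
    rw [hs, hs] at h2
    refine tendsto_nhds_unique h1 (h2.congr fun n => ?_)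
    rw [dist_eq_norm, ← smul_sub, norm_smul, norm_inv, Real.norm_of_nonneg (hr n).le,
      sub_sub_sub_cancel_right, ← dist_eq_norm, inv_mul_eq_div]
    rfl
  have : SecondCountableTopology Ω := hiso.isEmbedding.secondCountableTopology
  infer_instance
end
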